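/- arXiv:1803.08758 — 7 statements merged into one kernel-verified Lean document; each statement's English description precedes it below -/
import Mathlib

section
/- Let (Ω, 𝒜, λ) be a probability space and let ℬ₀, ℬ₁ be sub-σ-algebras of 𝒜. Then the following are equivalent: (a) ℬ₀ and ℬ₁ are conditionally independent relative to ℬ₀ ∧_λ ℬ₁; (b) for every bounded measurable f : Ω → ℝ one has E(E(f | ℬ₀) | ℬ₁) = E(f | ℬ₀ ∧_λ ℬ₁) λ-almost everywhere; (c) for every bounded measurable f : Ω → ℝ one has E(E(f | ℬ₁) | ℬ₀) = E(f | ℬ₀ ∧_λ ℬ₁) λ-almost everywhere. -/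
open MeasureTheory Set

/-- The meet `ℬ₀ ∧_μ ℬ₁` of two sub-σ-algebras relative to a measure `μ`:
the σ-algebra of all (ambient-)measurable sets `s` admitting `b₀ ∈ ℬ₀` and `b₁ ∈ ℬ₁`
with `μ (s ∆ b₀) = μ (s ∆ b₁) = 0`. -/
def meetAlg {α : Type*} {mα : MeasurableSpace α} (μ : Measure α)
    (B0 B1 : MeasurableSpace α) : MeasurableSpace α where
  MeasurableSet' s := MeasurableSet[mα] s ∧
    (∃ b0, MeasurableSet[B0] b0 ∧ μ (symmDiff s b0) = 0) ∧
    (∃ b1, MeasurableSet[B1] b1 ∧ μ (symmDiff s b1) = 0)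
  measurableSet_empty :=
    ⟨@MeasurableSet.empty _ mα, ⟨∅, @MeasurableSet.empty _ B0, by simp⟩,
      ⟨∅, @MeasurableSet.empty _ B1, by simp⟩⟩
  measurableSet_compl := by
    rintro s ⟨hs, ⟨b0, hb0, h0⟩, ⟨b1, hb1, h1⟩⟩
    exact ⟨hs.compl, ⟨b0ᶜ, hb0.compl, by rwa [compl_symmDiff_compl]⟩,
      ⟨b1ᶜ, hb1.compl, by rwa [compl_symmDiff_compl]⟩⟩
  measurableSet_iUnion := by
    intro f hf
    have key : ∀ (s b : ℕ → Set α),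
        symmDiff (⋃ i, s i) (⋃ i, b i) ⊆ ⋃ i, symmDiff (s i) (b i) := by
      intro s b x hx
      rw [Set.mem_symmDiff] at hx
      rcases hx with ⟨hx1, hx2⟩ | ⟨hx1, hx2⟩
      · obtain ⟨i, hi⟩ := Set.mem_iUnion.1 hx1
        exact Set.mem_iUnion.2 ⟨i, Set.mem_symmDiff.2
          (Or.inl ⟨hi, fun h => hx2 (Set.mem_iUnion.2 ⟨i, h⟩)⟩)⟩
      · obtain ⟨i, hi⟩ := Set.mem_iUnion.1 hx1
        exact Set.mem_iUnion.2 ⟨i, Set.mem_symmDiff.2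
          (Or.inr ⟨hi, fun h => hx2 (Set.mem_iUnion.2 ⟨i, h⟩)⟩)⟩
    choose hmeas h0 h1 using hf
    choose b0 hb0 hb0' using h0
    choose b1 hb1 hb1' using h1
    exact ⟨MeasurableSet.iUnion hmeas,
      ⟨⋃ i, b0 i, MeasurableSet.iUnion hb0,
        measure_mono_null (key f b0) (measure_iUnion_null hb0')⟩,
      ⟨⋃ i, b1 i, MeasurableSet.iUnion hb1,
        measure_mono_null (key f b1) (measure_iUnion_null hb1')⟩⟩

/-- Conditional independence of the sub-σ-algebras `B0` and `B1` relative to `B`,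
with respect to the measure `μ`: `E(f₀ f₁ | B) = E(f₀ | B) ⬝ E(f₁ | B)` a.e. for all
bounded `B0`- resp. `B1`-measurable real functions. -/
def CondIndepRel {α : Type*} {mα : MeasurableSpace α} (μ : Measure α)
    (B0 B1 B : MeasurableSpace α) : Prop :=
  ∀ f0 f1 : α → ℝ, Measurable[B0] f0 → Measurable[B1] f1 →
    (∃ C, ∀ x, |f0 x| ≤ C) → (∃ C, ∀ x, |f1 x| ≤ C) →
    μ[fun x => f0 x * f1 x|B] =ᵐ[μ] fun x => (μ[f0|B]) x * (μ[f1|B]) x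

/-- Every set of `M` agrees up to a `μ`-null set with a set of `B`. -/
def AELe {Ω : Type*} {mΩ : MeasurableSpace Ω} (μ : Measure Ω) (M B : MeasurableSpace Ω) : Prop :=
  ∀ s, MeasurableSet[M] s → ∃ b, MeasurableSet[B] b ∧ s =ᵐ[μ] b

theorem AELe.aesm {Ω : Type*} {mΩ : MeasurableSpace Ω} {μ : Measure Ω} {M B : MeasurableSpace Ω}
    (h : AELe μ M B) {g : Ω → ℝ} (hg : StronglyMeasurable[M] g) :
    AEStronglyMeasurable[B] g μ := by
  have hs : ∀ φ : @SimpleFunc Ω M ℝ, AEStronglyMeasurable[B] φ μ := by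
    intro φ
    induction φ using SimpleFunc.induction with
    | const c hs =>
      rename_i s
      obtain ⟨b, hb, hsb⟩ := h s hs
      refine ⟨b.indicator (fun _ => c), ?_, ?_⟩
      · exact (@stronglyMeasurable_const _ _ B _ c).indicator hb
      · filter_upwards [hsb] with x hx
        have hx' : x ∈ s ↔ x ∈ b := iff_of_eq hx
        by_cases hxs : x ∈ s
        · have hxb := hx'.1 hxs
          simp [SimpleFunc.coe_piecewise, Set.piecewise, hxs, hxb]
        · have hxb : x ∉ b := fun h => hxs (hx'.2 h)
          simp [SimpleFunc.coe_piecewise, Set.piecewise, hxs, hxb]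
    | add hd hf hg =>
      exact hf.add hg
  choose ψ hψ hψe using fun n => hs (hg.approx n)
  refine ⟨fun x => Filter.limsup (fun n => ψ n x) Filter.atTop, ?_, ?_⟩
  · exact (Measurable.limsup fun n => (hψ n).measurable).stronglyMeasurable
  · filter_upwards [ae_all_iff.2 hψe] with x hx
    have ht := hg.tendsto_approx x
    simp only [hx] at ht
    exact ht.limsup_eq.symm

theorem AELe.tower {Ω : Type*} {mΩ : MeasurableSpace Ω} {μ : Measure Ω} [IsProbabilityMeasure μ]
    {M B : MeasurableSpace Ω} (h : AELe μ M B) (hM : M ≤ mΩ) (hB : B ≤ mΩ) {f : Ω → ℝ}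
    (hf : Integrable f μ) : μ[μ[f|B]|M] =ᵐ[μ] μ[f|M] := by
  refine ae_eq_condExp_of_forall_setIntegral_eq hM hf
    (fun _ _ _ => integrable_condExp.integrableOn) ?_
    stronglyMeasurable_condExp.aestronglyMeasurable
  intro s hs _
  obtain ⟨b, hb, hsb⟩ := h s hs
  rw [setIntegral_condExp hM integrable_condExp hs, setIntegral_congr_set hsb,
    setIntegral_condExp hB hf hb, setIntegral_congr_set hsb]

theorem bdd_integrable {Ω : Type*} {mΩ : MeasurableSpace Ω} {μ : Measure Ω}
    [IsProbabilityMeasure μ] {f : Ω → ℝ} (hf : Measurable f) (hb : ∃ C, ∀ x, |f x| ≤ C) :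
    Integrable f μ := by
  obtain ⟨C, hC⟩ := hb
  exact Integrable.of_bound hf.aestronglyMeasurable C (Filter.Eventually.of_forall hC)

theorem core {Ω : Type*} {mΩ : MeasurableSpace Ω} (μ : Measure Ω) [IsProbabilityMeasure μ]
    (B0 B1 M : MeasurableSpace Ω) (hB0 : B0 ≤ mΩ) (hB1 : B1 ≤ mΩ) (hM : M ≤ mΩ)
    (h0 : AELe μ M B0) (h1 : AELe μ M B1) :
    CondIndepRel μ B0 B1 M ↔
      ∀ f : Ω → ℝ, Measurable[mΩ] f → (∃ C, ∀ x, |f x| ≤ C) →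
        μ[μ[f|B0]|B1] =ᵐ[μ] μ[f|M] := by
  constructor
  · intro hci f hf hfb
    have hfi : Integrable f μ := bdd_integrable hf hfb
    obtain ⟨C, hC⟩ := hfb
    let g : Ω → ℝ := fun x => max (-C) (min ((μ[f|B0]) x) C)
    have hgm : Measurable[B0] g :=
      Measurable.max measurable_const
        (Measurable.min stronglyMeasurable_condExp.measurable measurable_const)
    have hgb : ∃ C, ∀ x, |g x| ≤ C := by
      refine ⟨|C|, fun x => ?_⟩
      have hC0 : 0 ≤ C := (abs_nonneg _).trans (hC x)
      rw [abs_of_nonneg hC0, abs_le]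
      exact ⟨le_max_left _ _, max_le (by linarith) (min_le_right _ _)⟩
    have hgi : Integrable g μ := bdd_integrable (hgm.mono hB0 le_rfl) hgb
    have hge : μ[f|B0] =ᵐ[μ] g := by
      filter_upwards [ae_bdd_abs_condExp_of_ae_bdd_abs (m := B0) (μ := μ) (f := f) (R := C)
        (Filter.Eventually.of_forall hC)] with x hx
      have := abs_le.1 hx
      simp only [g]
      rw [min_eq_left this.2, max_eq_right this.1]
    have key : μ[g|M] =ᵐ[μ] μ[g|B1] := by
      refine ae_eq_condExp_of_forall_setIntegral_eq hB1 hgi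
        (fun _ _ _ => integrable_condExp.integrableOn) ?_
        (h1.aesm stronglyMeasurable_condExp)
      intro s hs _
      let u : Ω → ℝ := s.indicator (fun _ => 1)
      have hum : Measurable[B1] u := (@measurable_const _ _ _ B1 (1 : ℝ)).indicator hs
      have hub : ∀ x, |u x| ≤ 1 := by
        intro x
        by_cases hx : x ∈ s <;> simp [u, hx]
      have hui : Integrable u μ := bdd_integrable (hum.mono hB1 le_rfl) ⟨1, hub⟩
      have e : ∀ k : Ω → ℝ, ∫ x in s, k x ∂μ = ∫ x, k x * u x ∂μ := by
        intro k
        rw [← integral_indicator (hB1 s hs)]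
        congr 1
        ext x
        by_cases hx : x ∈ s <;> simp [u, hx]
      have hmi : ∀ k : Ω → ℝ, Integrable k μ → Integrable (fun x => k x * u x) μ := by
        intro k hk
        exact hk.mul_bdd (c := 1) (hum.mono hB1 le_rfl).aestronglyMeasurable
          (Filter.Eventually.of_forall hub)
      rw [e, e, ← integral_condExp hM, ← integral_condExp (f := fun x => g x * u x) hM]
      refine integral_congr_ae ?_
      have a1 := hci g u hgm hum hgb ⟨1, hub⟩
      have a2 : μ[fun x => (μ[g|M]) x * u x|M] =ᵐ[μ] fun x => (μ[g|M]) x * (μ[u|M]) x :=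
        condExp_mul_of_stronglyMeasurable_left stronglyMeasurable_condExp
          (hmi _ integrable_condExp) hui
      exact a2.trans a1.symm
    calc μ[μ[f|B0]|B1] =ᵐ[μ] μ[g|B1] := condExp_congr_ae hge
      _ =ᵐ[μ] μ[g|M] := key.symm
      _ =ᵐ[μ] μ[μ[f|B0]|M] := condExp_congr_ae hge.symm
      _ =ᵐ[μ] μ[f|M] := h0.tower hM hB0 hfi
  · intro hb f0 f1 hf0 hf1 hb0 hb1
    have hf0' := hf0.mono hB0 le_rfl
    have hf1' := hf1.mono hB1 le_rfl
    have hi0 : Integrable f0 μ := bdd_integrable hf0' hb0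
    have hi1 : Integrable f1 μ := bdd_integrable hf1' hb1
    have a0 := hb f0 hf0' hb0
    rw [condExp_of_stronglyMeasurable hB0 hf0.stronglyMeasurable hi0] at a0
    obtain ⟨C, hC⟩ := hb1
    have hmi : ∀ k : Ω → ℝ, Integrable k μ → Integrable (fun x => k x * f1 x) μ := by
      intro k hk
      exact hk.mul_bdd (c := C) hf1'.aestronglyMeasurable (Filter.Eventually.of_forall hC)
    have a1 : μ[fun x => f0 x * f1 x|B1] =ᵐ[μ] fun x => (μ[f0|B1]) x * f1 x :=
      condExp_mul_of_stronglyMeasurable_right hf1.stronglyMeasurable (hmi _ hi0) hi0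
    have a2 : (fun x => (μ[f0|B1]) x * f1 x) =ᵐ[μ] fun x => (μ[f0|M]) x * f1 x := by
      filter_upwards [a0] with x hx
      rw [hx]
    have a3 : μ[fun x => (μ[f0|M]) x * f1 x|M] =ᵐ[μ] fun x => (μ[f0|M]) x * (μ[f1|M]) x :=
      condExp_mul_of_stronglyMeasurable_left stronglyMeasurable_condExp
        (hmi _ integrable_condExp) hi1
    exact ((h1.tower hM hB1 (hmi _ hi0)).symm.trans (condExp_congr_ae (a1.trans a2))).trans a3

theorem CondIndepRel.swap {Ω : Type*} {mΩ : MeasurableSpace Ω} {μ : Measure Ω}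
    {B0 B1 M : MeasurableSpace Ω} (h : CondIndepRel μ B0 B1 M) : CondIndepRel μ B1 B0 M := by
  intro f0 f1 hf0 hf1 hb0 hb1
  have := h f1 f0 hf1 hf0 hb1 hb0
  simpa only [mul_comm] using this

/-- **Characterization of conditional independence via composed conditional expectations**
(Proposition 2.6 / Proposition A.5). For sub-σ-algebras `ℬ₀, ℬ₁` of a probability space,
the following are equivalent: (a) `ℬ₀` and `ℬ₁` are conditionally independent relative to
their meet `ℬ₀ ∧_μ ℬ₁`; (b) for every bounded measurable `f`,
`E(E(f|ℬ₀)|ℬ₁) = E(f|ℬ₀ ∧_μ ℬ₁)` a.e.; (c) likewise with `ℬ₀` and `ℬ₁` swapped. -/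
theorem condIndep_iff_iterated_condexp
    {Ω : Type*} [mΩ : MeasurableSpace Ω] (μ : Measure Ω) [IsProbabilityMeasure μ]
    (B0 B1 : MeasurableSpace Ω) (hB0 : B0 ≤ mΩ) (hB1 : B1 ≤ mΩ) :
    (CondIndepRel μ B0 B1 (meetAlg μ B0 B1) ↔
      ∀ f : Ω → ℝ, Measurable[mΩ] f → (∃ C, ∀ x, |f x| ≤ C) →
        μ[μ[f|B0]|B1] =ᵐ[μ] μ[f|meetAlg μ B0 B1]) ∧
    (CondIndepRel μ B0 B1 (meetAlg μ B0 B1) ↔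
      ∀ f : Ω → ℝ, Measurable[mΩ] f → (∃ C, ∀ x, |f x| ≤ C) →
        μ[μ[f|B1]|B0] =ᵐ[μ] μ[f|meetAlg μ B0 B1]) := by
  have hM : meetAlg μ B0 B1 ≤ mΩ := fun s hs => hs.1
  have h0 : AELe μ (meetAlg μ B0 B1) B0 := by
    rintro s ⟨-, ⟨b, hb, h⟩, -⟩
    exact ⟨b, hb, measure_symmDiff_eq_zero_iff.1 h⟩
  have h1 : AELe μ (meetAlg μ B0 B1) B1 := by
    rintro s ⟨-, -, ⟨b, hb, h⟩⟩
    exact ⟨b, hb, measure_symmDiff_eq_zero_iff.1 h⟩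
  exact ⟨core μ B0 B1 _ hB0 hB1 hM h0 h1,
    Iff.trans ⟨CondIndepRel.swap, CondIndepRel.swap⟩ (core μ B1 B0 _ hB1 hB0 hM h1 h0)⟩
end

section
/- Let (Ω, 𝒜, λ) be a probability space and let ℬ₀, ℬ₁ be sub-σ-algebras of 𝒜. Then ℬ₀ and ℬ₁ are conditionally independent relative to ℬ₀ ∧_λ ℬ₁ if and only if every bounded ℬ₀-measurable function f : Ω → ℝ with E(f | ℬ₀ ∧_λ ℬ₁) = 0 λ-almost everywhere satisfies E(f | ℬ₁) = 0 λ-almost everywhere. -/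
open MeasureTheory Set



open MeasureTheory Set

open Filter Topology in
/-- A function measurable for `m'` is a.e. equal to an `m`-measurable one as soon as
every `m'`-measurable set is a.e. equal to an `m`-measurable set. -/
lemma aux_aesm {Ω : Type*} {mΩ : MeasurableSpace Ω} (μ : Measure Ω)
    (m m' : MeasurableSpace Ω)
    (h : ∀ s, MeasurableSet[m'] s → ∃ b, MeasurableSet[m] b ∧ s =ᵐ[μ] b)
    (g : Ω → ℝ) (hg : StronglyMeasurable[m'] g) :
    ∃ g' : Ω → ℝ, StronglyMeasurable[m] g' ∧ g =ᵐ[μ] g' := by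
  have hs : ∀ f : @SimpleFunc Ω m' ℝ, ∃ f' : Ω → ℝ, StronglyMeasurable[m] f' ∧ (f : Ω → ℝ) =ᵐ[μ] f' := by
    intro f
    refine @SimpleFunc.induction Ω ℝ m' _
      (fun f => ∃ f' : Ω → ℝ, StronglyMeasurable[m] f' ∧ (f : Ω → ℝ) =ᵐ[μ] f') ?_ ?_ f
    · intro c s hs
      obtain ⟨b, hb, hsb⟩ := h s hs
      refine ⟨b.indicator (fun _ => c), stronglyMeasurable_const.indicator hb, ?_⟩
      have h1 : s.indicator (fun _ : Ω => c) =ᵐ[μ] b.indicator (fun _ => c) :=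
        @indicator_ae_eq_of_ae_eq_set _ _ mΩ _ _ _ _ _ hsb
      refine EventuallyEq.trans (EventuallyEq.of_eq ?_) h1
      ext x
      by_cases hx : x ∈ s <;> simp [hx]
    · rintro f g - ⟨f', hf', hff⟩ ⟨g', hg', hgg⟩
      exact ⟨f' + g', hf'.add hg', by simpa using hff.add hgg⟩
  choose f' hf' hff' using fun n => hs (hg.approx n)
  refine ⟨fun x => limUnder atTop (fun n => f' n x), ?_, ?_⟩
  · clear hff' hs hg h
    clear m' μ mΩ
    exact StronglyMeasurable.limUnder hf'
  filter_upwards [ae_all_iff.2 hff'] with x hx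
  have := hg.tendsto_approx x
  simp_rw [hx] at this
  exact this.limUnder_eq.symm

lemma aux_int {Ω : Type*} {mΩ : MeasurableSpace Ω} (μ : Measure Ω) [IsProbabilityMeasure μ]
    (m : MeasurableSpace Ω) (hm : m ≤ mΩ) (f : Ω → ℝ) (hf : Measurable[m] f)
    (C : ℝ) (hC : ∀ x, |f x| ≤ C) : Integrable f μ :=
  Integrable.of_bound (hf.mono hm le_rfl).aestronglyMeasurable C (ae_of_all _ hC)

lemma aux_meet_le {Ω : Type*} {mΩ : MeasurableSpace Ω} (μ : Measure Ω)
    (B0 B1 : MeasurableSpace Ω) : meetAlg μ B0 B1 ≤ mΩ := fun _ hs => hs.1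

lemma aux_forward {Ω : Type*} {mΩ : MeasurableSpace Ω} (μ : Measure Ω) [IsProbabilityMeasure μ]
    (B0 B1 : MeasurableSpace Ω) (hB0 : B0 ≤ mΩ) (hB1 : B1 ≤ mΩ)
    (h : CondIndepRel μ B0 B1 (meetAlg μ B0 B1)) (f : Ω → ℝ) (hf : Measurable[B0] f)
    (C : ℝ) (hC : ∀ x, |f x| ≤ C) (h0 : μ[f|meetAlg μ B0 B1] =ᵐ[μ] 0) : μ[f|B1] =ᵐ[μ] 0 := by
  have hfi := aux_int μ B0 hB0 f hf C hC
  symm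
  refine ae_eq_condExp_of_forall_setIntegral_eq hB1 hfi
    (fun s _ _ => (integrable_zero _ _ _).integrableOn) (fun s hs _ => ?_)
    (@stronglyMeasurable_zero _ _ B1 _ _).aestronglyMeasurable
  have h1 := h f (s.indicator fun _ => 1) hf
    ((@measurable_const _ _ _ B1 (1 : ℝ)).indicator hs) ⟨C, hC⟩
    ⟨1, fun x => by by_cases hx : x ∈ s <;> simp [hx]⟩
  have e : (fun x => f x * s.indicator (fun _ => (1:ℝ)) x) = s.indicator f := by
    ext x; by_cases hx : x ∈ s <;> simp [hx]
  rw [e] at h1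
  have h2 : μ[s.indicator f|meetAlg μ B0 B1] =ᵐ[μ] 0 := by
    filter_upwards [h1, h0] with x a b
    rw [a, b]; simp
  rw [← integral_indicator (hB1 _ hs), ← integral_indicator (hB1 _ hs),
    ← integral_condExp (aux_meet_le μ B0 B1) (f := s.indicator f), integral_congr_ae h2]
  simp

lemma aux_backward {Ω : Type*} {mΩ : MeasurableSpace Ω} (μ : Measure Ω) [IsProbabilityMeasure μ]
    (B0 B1 : MeasurableSpace Ω) (hB0 : B0 ≤ mΩ) (hB1 : B1 ≤ mΩ)
    (h : ∀ f : Ω → ℝ, Measurable[B0] f → (∃ C, ∀ x, |f x| ≤ C) →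
        μ[f|meetAlg μ B0 B1] =ᵐ[μ] 0 → μ[f|B1] =ᵐ[μ] 0) :
    CondIndepRel μ B0 B1 (meetAlg μ B0 B1) := by
  rintro f0 f1 hf0 hf1 ⟨C, hC⟩ ⟨D, hD⟩
  have hM := aux_meet_le μ B0 B1
  have i0 := aux_int μ B0 hB0 f0 hf0 C hC
  have i1 := aux_int μ B1 hB1 f1 hf1 D hD
  obtain ⟨g1, hg1, hgg⟩ := aux_aesm μ B0 (meetAlg μ B0 B1)
    (fun s hs => by
      obtain ⟨b, hb, hsb⟩ := hs.2.1
      exact ⟨b, hb, measure_symmDiff_eq_zero_iff.1 hsb⟩)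
    (μ[f0|meetAlg μ B0 B1]) stronglyMeasurable_condExp
  obtain ⟨g, hg, hgC, hge⟩ : ∃ g : Ω → ℝ, Measurable[B0] g ∧ (∀ x, |g x| ≤ |C|) ∧
      μ[f0|meetAlg μ B0 B1] =ᵐ[μ] g := by
    refine ⟨fun x => max (-|C|) (min |C| (g1 x)),
      (@measurable_const _ _ _ B0 (-|C|)).max
        ((@measurable_const _ _ _ B0 (|C|)).min hg1.measurable), fun x => ?_, ?_⟩
    · have := abs_nonneg C
      exact abs_le.2 ⟨le_max_left _ _, max_le (by linarith) (min_le_left _ _)⟩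
    · have hb := ae_bdd_condExp_of_ae_bdd (m := meetAlg μ B0 B1) (μ := μ) (R := ⟨|C|, abs_nonneg C⟩)
        (ae_of_all μ fun x => (hC x).trans (le_abs_self C))
      filter_upwards [hb, hgg] with x a b
      rw [← b]
      have a' := abs_le.1 a
      change -|C| ≤ _ ∧ _ ≤ |C| at a'
      rw [min_eq_right a'.2, max_eq_right a'.1]
  have ig := aux_int μ B0 hB0 g hg _ hgC
  have mk : Measurable[B0] (f0 - g) := hf0.sub hg
  have bk : ∀ x, |(f0 - g) x| ≤ C + |C| := fun x =>
    (abs_sub _ _).trans (add_le_add (hC x) (hgC x))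
  have ik : Integrable (f0 - g) μ := i0.sub ig
  have sf1 : StronglyMeasurable[B1] f1 := hf1.stronglyMeasurable
  have af1 : AEStronglyMeasurable[mΩ] f1 μ := (sf1.mono hB1).aestronglyMeasurable
  have ikf : Integrable ((f0 - g) * f1) μ := ik.mul_bdd (c := D) af1 (ae_of_all _ hD)
  have igf : Integrable (g * f1) μ := ig.mul_bdd (c := D) af1 (ae_of_all _ hD)
  have z : μ[f0 - g|B1] =ᵐ[μ] 0 := by
    refine h _ mk ⟨_, bk⟩ ?_
    have e1 := condExp_sub i0 ig (meetAlg μ B0 B1)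
    have e2 := condExp_congr_ae (m := meetAlg μ B0 B1) hge
    rw [condExp_of_stronglyMeasurable hM stronglyMeasurable_condExp integrable_condExp] at e2
    filter_upwards [e1, e2] with x a b
    rw [a]; simp [b]
  have z1 : μ[(f0 - g) * f1|B1] =ᵐ[μ] 0 := by
    filter_upwards [condExp_mul_of_stronglyMeasurable_right sf1 ikf ik, z] with x a b
    rw [a]; simp [b]
  have z2 : 0 =ᵐ[μ] μ[(f0 - g) * f1|meetAlg μ B0 B1] := by
    refine ae_eq_condExp_of_forall_setIntegral_eq hM ikf
      (fun s _ _ => (integrable_zero _ _ _).integrableOn) (fun s hs _ => ?_)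
      (@stronglyMeasurable_zero _ _ (meetAlg μ B0 B1) _ _).aestronglyMeasurable
    obtain ⟨b, hb, hsb⟩ := hs.2.2
    rw [setIntegral_congr_set (f := (f0 - g) * f1) (measure_symmDiff_eq_zero_iff.1 hsb),
      ← setIntegral_condExp hB1 ikf hb, integral_congr_ae (ae_restrict_of_ae z1)]
    simp
  have w := condExp_mul_of_aestronglyMeasurable_left (m := meetAlg μ B0 B1) (μ := μ)
    (f := g) (g := f1) ⟨_, stronglyMeasurable_condExp, hge.symm⟩ igf i1
  have e : (fun x => f0 x * f1 x) = (f0 - g) * f1 + g * f1 := by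
    ext x; simp; ring
  rw [e]
  filter_upwards [condExp_add ikf igf (meetAlg μ B0 B1), z2, w, hge] with x a b c d
  rw [a, Pi.add_apply, ← b, c, Pi.mul_apply, d]; simp

/-- **Criterion for conditional independence** (Lemma 2.7). `ℬ₀` and `ℬ₁` are conditionally
independent relative to their meet `ℬ₀ ∧_μ ℬ₁` if and only if every bounded `ℬ₀`-measurable
function `f` with `E(f | ℬ₀ ∧_μ ℬ₁) = 0` a.e. satisfies `E(f | ℬ₁) = 0` a.e. -/
theorem condIndep_iff_zero_meet_condexp
    {Ω : Type*} [mΩ : MeasurableSpace Ω] (μ : Measure Ω) [IsProbabilityMeasure μ]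
    (B0 B1 : MeasurableSpace Ω) (hB0 : B0 ≤ mΩ) (hB1 : B1 ≤ mΩ) :
    CondIndepRel μ B0 B1 (meetAlg μ B0 B1) ↔
      ∀ f : Ω → ℝ, Measurable[B0] f → (∃ C, ∀ x, |f x| ≤ C) →
        μ[f|meetAlg μ B0 B1] =ᵐ[μ] 0 → μ[f|B1] =ᵐ[μ] 0 := by
  constructor
  · rintro h f hf ⟨C, hC⟩ h0
    exact aux_forward μ B0 B1 hB0 hB1 h f hf C hC h0
  · exact aux_backward μ B0 B1 hB0 hB1
end

section
/- Let (Ω, 𝒜) be a standard Borel space, let λ be a probability measure on it, and let S be a finite set. Call a set R ⊆ Ω^S a measurable product-set if R = ∏_{v∈S} B_v with all B_v ∈ 𝒜. Let h be a [0,1]-valued function on the measurable product-sets such that: (i) whenever a measurable product-set R is the disjoint union of finitely many measurable product-sets R₁, …, R_k, then h(R) = Σ_{i=1}^k h(R_i); and (ii) for every w ∈ S and every B ∈ 𝒜, h(p_w^{-1}(B)) = λ(B), where p_w : Ω^S → Ω is the coordinate projection. Then there exists a unique measure μ on the product σ-algebra 𝒜^S with μ(R) = h(R) for every measurable product-set R,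 and this μ is a self-coupling of λ indexed by S. -/
open MeasureTheory Set
open scoped ENNReal

/-- The family of measurable product-sets. -/
def cpBoxes (S Ω : Type*) [MeasurableSpace Ω] : Set (Set (S → Ω)) :=
  pi univ '' pi univ (fun _ : S => {s : Set Ω | MeasurableSet s})

lemma cp_mem {S Ω : Type*} [MeasurableSpace Ω] (B : S → Set Ω) (hB : ∀ v, MeasurableSet (B v)) :
    univ.pi B ∈ cpBoxes S Ω := ⟨B, fun v _ => hB v, rfl⟩

lemma cp_semiring {S Ω : Type*} [MeasurableSpace Ω] [Fintype S] [Nonempty S] :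
    IsSetSemiring (cpBoxes S Ω) where
  empty_mem := by
    refine ⟨fun _ => ∅, fun _ _ => MeasurableSet.empty, ?_⟩
    exact Set.univ_pi_empty
  inter_mem := by
    rintro _ ⟨B, hB, rfl⟩ _ ⟨C, hC, rfl⟩
    rw [← Set.pi_inter_distrib]
    exact cp_mem _ fun v => MeasurableSet.inter (hB v trivial) (hC v trivial)
  sdiff_eq_sUnion' := by
    classical
    rintro _ ⟨B, hB, rfl⟩ _ ⟨C, hC, rfl⟩
    let F : Finset S → Set (S → Ω) := fun T =>
      univ.pi (fun v => if v ∈ T then B v \ C v else B v ∩ C v)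
    have key : ∀ T x, x ∈ F T ↔ (x ∈ univ.pi B ∧ ∀ v, v ∈ T ↔ x v ∉ C v) := by
      intro T x
      simp only [F, mem_univ_pi]
      constructor
      · intro hx
        refine ⟨fun v => ?_, fun v => ?_⟩
        · have := hx v; split_ifs at this <;> exact this.1
        · have := hx v
          split_ifs at this with hv
          · exact ⟨fun _ => this.2, fun _ => hv⟩
          · exact ⟨fun h => absurd h hv, fun h => absurd this.2 h⟩
      · rintro ⟨hx, hT⟩ v
        split_ifs with hv
        · exact ⟨hx v, (hT v).1 hv⟩
        · exact ⟨hx v, by by_contra h; exact hv ((hT v).2 h)⟩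
    refine ⟨(Finset.univ.filter (fun T : Finset S => T ≠ ∅)).image F, ?_, ?_, ?_⟩
    · intro s hs
      simp only [Finset.coe_image, mem_image] at hs
      obtain ⟨T, -, rfl⟩ := hs
      refine cp_mem _ fun v => ?_
      split_ifs
      · exact MeasurableSet.diff (hB v trivial) (hC v trivial)
      · exact MeasurableSet.inter (hB v trivial) (hC v trivial)
    · intro s hs t ht hst
      simp only [Finset.coe_image, mem_image] at hs ht
      obtain ⟨T, -, rfl⟩ := hs
      obtain ⟨T', -, rfl⟩ := ht
      simp only [Function.onFun, id]
      rw [Set.disjoint_left]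
      intro x hx hx'
      apply hst
      congr 1
      ext v
      rw [((key _ _).1 hx).2 v, ((key _ _).1 hx').2 v]
    · ext x
      simp only [mem_sdiff, mem_sUnion, Finset.coe_image, mem_image]
      constructor
      · rintro ⟨h1, h2⟩
        refine ⟨_, ⟨Finset.univ.filter (fun v => x v ∉ C v), ?_, rfl⟩, (key _ _).2 ⟨h1, by simp⟩⟩
        simp only [mem_univ_pi, not_forall] at h2
        obtain ⟨v, hv⟩ := h2
        simp only [Finset.coe_filter, Finset.mem_univ, true_and, mem_setOf_eq]
        exact Finset.ne_empty_of_mem (a := v) (by simp [hv])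
      · rintro ⟨_, ⟨T, hT, rfl⟩, hx⟩
        obtain ⟨h1, h2⟩ := (key _ _).1 hx
        refine ⟨h1, fun h3 => ?_⟩
        simp only [Finset.coe_filter, Finset.mem_univ, true_and, mem_setOf_eq] at hT
        obtain ⟨v, hv⟩ := Finset.nonempty_iff_ne_empty.2 hT
        exact (h2 v).1 hv (h3 v trivial)

lemma cp_subadd {α ι : Type*} {C : Set (Set α)} (hC : IsSetSemiring C) (m : AddContent ℝ≥0∞ C)
    (a : Finset ι) (f : ι → Set α) (hf : ∀ i ∈ a, f i ∈ C) {t : Set α} (ht : t ∈ C)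
    (hsub : t ⊆ ⋃ i ∈ a, f i) : m t ≤ ∑ i ∈ a, m (f i) := by
  classical
  refine (addContent_le_sum_of_subset_sUnion hC (J := a.image f) ?_ ht ?_).trans ?_
  · intro s hs
    simp only [Finset.coe_image, mem_image] at hs
    obtain ⟨i, hi, rfl⟩ := hs
    exact hf i hi
  · simpa using hsub
  · exact Finset.sum_image_le_of_nonneg (fun _ _ => zero_le)

lemma cp_approx {S Ω : Type*} [MeasurableSpace Ω] [Fintype S] [Nonempty S] (lam : Measure Ω)
    (m : AddContent ℝ≥0∞ (cpBoxes S Ω))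
    (hmarg : ∀ (w : S) (B : Set Ω), MeasurableSet B →
      m ((fun ω : S → Ω => ω w) ⁻¹' B) = lam B)
    (B C : S → Set Ω) (hB : ∀ v, MeasurableSet (B v)) (hC : ∀ v, MeasurableSet (C v)) :
    m (univ.pi B) ≤ m (univ.pi C) + ∑ v, lam (B v \ C v) := by
  classical
  let f : Option S → Set (S → Ω) := fun o =>
    o.elim (univ.pi C) (fun v => (fun ω : S → Ω => ω v) ⁻¹' (B v \ C v))
  have := cp_subadd cp_semiring m Finset.univ f (t := univ.pi B) ?_ (cp_mem B hB) ?_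
  · rw [Fintype.sum_option] at this
    refine this.trans (le_of_eq ?_)
    simp only [f, Option.elim]
    congr 1
    exact Finset.sum_congr rfl fun v _ => hmarg v _ ((hB v).diff (hC v))
  · rintro (_ | v) -
    · exact cp_mem C hC
    · have : f (some v) = univ.pi (Function.update (fun _ => univ) v (B v \ C v)) := by
        rw [Set.univ_pi_update_univ]; rfl
      rw [this]
      refine cp_mem _ fun w => ?_
      by_cases hw : w = v
      · subst hw; simpa using (hB w).diff (hC w)
      · simp [Function.update_of_ne hw]
  · intro x hx
    simp only [Finset.mem_univ, iUnion_true, mem_iUnion]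
    by_cases h : x ∈ univ.pi C
    · exact ⟨none, h⟩
    · simp only [mem_univ_pi, not_forall] at h
      obtain ⟨v, hv⟩ := h
      exact ⟨some v, hx v trivial, hv⟩

lemma cp_sigma {S Ω : Type*} [MeasurableSpace Ω] [StandardBorelSpace Ω] [Fintype S] [Nonempty S]
    (lam : Measure Ω) [IsProbabilityMeasure lam]
    (m : AddContent ℝ≥0∞ (cpBoxes S Ω))
    (hmarg : ∀ (w : S) (B : Set Ω), MeasurableSet B →
      m ((fun ω : S → Ω => ω w) ⁻¹' B) = lam B) : m.IsSigmaSubadditive := by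
  classical
  letI := upgradeStandardBorel Ω
  intro f hf hU
  choose A hA hAf using hf
  obtain ⟨B, hB, hBU⟩ := hU
  have hA : ∀ i v, MeasurableSet (A i v) := fun i v => hA i v trivial
  have hB : ∀ v, MeasurableSet (B v) := fun v => hB v trivial
  rw [← hBU]
  have hcard : (Fintype.card S : ℝ≥0∞) ≠ 0 := by simp
  have hcard' : (Fintype.card S : ℝ≥0∞) ≠ ∞ := by simp
  refine ENNReal.le_of_forall_pos_le_add fun ε hε _ => ?_
  have hε2 : (ε / 2 : ℝ≥0∞) ≠ 0 := by simpa using hε.ne'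
  obtain ⟨δ, hδ, hδs⟩ := ENNReal.exists_pos_sum_of_countable' hε2 ℕ
  have hK : ∀ v, ∃ K ⊆ B v, IsCompact K ∧ lam (B v \ K) < (ε / 2) / Fintype.card S := fun v =>
    (hB v).exists_isCompact_sdiff_lt (measure_ne_top _ _) (ENNReal.div_pos hε2 hcard').ne'
  choose K hKB hKc hKl using hK
  have hV : ∀ i v, ∃ U, U ⊇ A i v ∧ IsOpen U ∧ lam U < ∞ ∧
      lam (U \ A i v) < δ i / Fintype.card S := fun i v =>
    (hA i v).exists_isOpen_sdiff_lt (measure_ne_top _ _) (ENNReal.div_pos (hδ i).ne' hcard').ne'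
  choose V hAV hVo _ hVl using hV
  have hsum : ∀ (c : ℝ≥0∞) (g : S → ℝ≥0∞), (∀ v, g v < c / Fintype.card S) → ∑ v, g v ≤ c := by
    intro c g hg
    calc ∑ v, g v ≤ ∑ _v : S, c / Fintype.card S := Finset.sum_le_sum fun v _ => (hg v).le
      _ = c := by
        rw [Finset.sum_const, nsmul_eq_mul, Finset.card_univ, ENNReal.mul_div_cancel hcard hcard']
  have hcomp : IsCompact (univ.pi K) := isCompact_univ_pi hKc
  obtain ⟨t, ht⟩ := hcomp.elim_finite_subcover (fun i => univ.pi (V i))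
    (fun i => isOpen_set_pi finite_univ fun v _ => hVo i v) (by
      intro x hx
      have : x ∈ ⋃ i, f i := by
        rw [← hBU]; exact fun v _ => hKB v (hx v trivial)
      obtain ⟨i, hi⟩ := mem_iUnion.1 this
      rw [← hAf i] at hi
      exact mem_iUnion.2 ⟨i, fun v _ => hAV i v (hi v trivial)⟩)
  have hKm : ∀ v, MeasurableSet (K v) := fun v => (hKc v).measurableSet
  have hVm : ∀ i v, MeasurableSet (V i v) := fun i v => (hVo i v).measurableSet
  calc m (univ.pi B) ≤ m (univ.pi K) + ∑ v, lam (B v \ K v) :=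
        cp_approx lam m hmarg B K hB hKm
    _ ≤ m (univ.pi K) + ε / 2 := by gcongr; exact hsum _ _ hKl
    _ ≤ (∑ i ∈ t, m (univ.pi (V i))) + ε / 2 := by
        gcongr
        exact cp_subadd cp_semiring m t _ (fun i _ => cp_mem _ (hVm i)) (cp_mem _ hKm) ht
    _ ≤ (∑ i ∈ t, (m (f i) + δ i)) + ε / 2 := by
        gcongr with i hi
        rw [← hAf i]
        refine (cp_approx lam m hmarg (V i) (A i) (hVm i) (hA i)).trans ?_
        gcongr
        exact hsum _ _ (hVl i)
    _ ≤ (∑' i, (m (f i) + δ i)) + ε / 2 := by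
        gcongr
        exact ENNReal.sum_le_tsum t
    _ ≤ (∑' i, m (f i) + ε / 2) + ε / 2 := by
        rw [ENNReal.tsum_add]
        gcongr
    _ = ∑' i, m (f i) + ε := by rw [add_assoc, ENNReal.add_halves]

/-- **Existence and uniqueness of couplings from premeasures on product-sets**
(Lemma A.10 / Lemma 2.17). Let `Ω` be a standard Borel space, `λ` a probability measure
on it, and `S` a finite index set. If `h` is a `[0,1]`-valued set function, additive on
the semiring of measurable product-sets and with marginals given by `λ`, then there is a
unique measure `μ` on the product σ-algebra agreeing with `h` on measurable product-sets,
and this `μ` is a self-coupling of `λ` indexed by `S`. -/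
theorem coupling_from_premeasure
    {Ω : Type*} [MeasurableSpace Ω] [StandardBorelSpace Ω]
    (lam : Measure Ω) [IsProbabilityMeasure lam]
    {S : Type*} [Fintype S]
    (h : Set (S → Ω) → ℝ≥0∞)
    (hrange : ∀ B : S → Set Ω, (∀ v, MeasurableSet (B v)) → h (Set.univ.pi B) ≤ 1)
    (hadd : ∀ (B : S → Set Ω), (∀ v, MeasurableSet (B v)) →
      ∀ (k : ℕ) (Bs : Fin k → S → Set Ω), (∀ i v, MeasurableSet (Bs i v)) →
      (Set.univ.pi B = ⋃ i, Set.univ.pi (Bs i)) →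
      (∀ i j, i ≠ j → Disjoint (Set.univ.pi (Bs i)) (Set.univ.pi (Bs j))) →
      h (Set.univ.pi B) = ∑ i, h (Set.univ.pi (Bs i)))
    (hmarg : ∀ (w : S) (B : Set Ω), MeasurableSet B →
      h ((fun ω : S → Ω => ω w) ⁻¹' B) = lam B) :
    ∃ μ : Measure (S → Ω),
      (∀ B : S → Set Ω, (∀ v, MeasurableSet (B v)) →
        μ (Set.univ.pi B) = h (Set.univ.pi B)) ∧
      (∀ v : S, μ.map (fun ω => ω v) = lam) ∧
      ∀ μ' : Measure (S → Ω),
        (∀ B : S → Set Ω, (∀ v, MeasurableSet (B v)) →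
          μ' (Set.univ.pi B) = h (Set.univ.pi B)) → μ' = μ := by
  classical
  have hgen : (MeasurableSpace.pi : MeasurableSpace (S → Ω)) =
      MeasurableSpace.generateFrom (cpBoxes S Ω) := generateFrom_pi.symm
  have hpi : IsPiSystem (cpBoxes S Ω) := isPiSystem_pi
  suffices hex : ∃ μ : Measure (S → Ω), ∀ B : S → Set Ω, (∀ v, MeasurableSet (B v)) →
        μ (Set.univ.pi B) = h (Set.univ.pi B) by
    obtain ⟨μ, hμ⟩ := hex
    have huniv : (univ : Set (S → Ω)) = univ.pi (fun _ => univ) := by simp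
    refine ⟨μ, hμ, fun v => ?_, fun μ' hμ' => ?_⟩
    · ext s hs
      rw [Measure.map_apply (measurable_pi_apply v) hs, ← hmarg v s hs]
      have : (fun ω : S → Ω => ω v) ⁻¹' s = univ.pi (Function.update (fun _ => univ) v s) := by
        rw [Set.univ_pi_update_univ]
      rw [this]
      refine hμ _ fun w => ?_
      by_cases hw : w = v
      · subst hw; simpa using hs
      · simp [Function.update_of_ne hw]
    · haveI : IsFiniteMeasure μ' := ⟨by
        rw [huniv, hμ' _ fun _ => MeasurableSet.univ]
        exact (hrange _ fun _ => MeasurableSet.univ).trans_lt ENNReal.one_lt_top⟩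
      refine ext_of_generate_finite _ hgen hpi ?_ ?_
      · rintro _ ⟨B, hB, rfl⟩
        rw [hμ _ fun v => hB v trivial, hμ' _ fun v => hB v trivial]
      · rw [huniv, hμ _ fun _ => MeasurableSet.univ, hμ' _ fun _ => MeasurableSet.univ]
  rcases isEmpty_or_nonempty S with hS | hS
  · refine ⟨h univ • Measure.dirac (fun v => hS.elim v), fun B _ => ?_⟩
    have : univ.pi B = univ := by ext x; simp
    rw [this]
    simp
  · let m : AddContent ℝ≥0∞ (cpBoxes S Ω) :=
      { toFun := h
        empty' := by
          have := hadd (fun _ => ∅) (fun _ => MeasurableSet.empty) 0 (fun _ _ => ∅)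
            (fun _ _ => MeasurableSet.empty) (by simp) (fun i => i.elim0)
          simpa using this
        sUnion' := by
          intro I hI hd hmem
          obtain ⟨B, hB, hBU⟩ := hmem
          have hI' : ∀ i : Fin I.card, ∃ C : S → Set Ω, (∀ v, MeasurableSet (C v)) ∧
              univ.pi C = (I.equivFin.symm i : Set (S → Ω)) := by
            intro i
            obtain ⟨C, hC, hCe⟩ := hI (I.equivFin.symm i).2
            exact ⟨C, fun v => hC v trivial, hCe⟩
          choose C hC hCe using hI'
          have := hadd B (fun v => hB v trivial) I.card C hC ?_ ?_
          · rw [← hBU, this]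
            simp only [hCe]
            rw [← Finset.sum_coe_sort I]
            exact Equiv.sum_comp I.equivFin.symm (fun s : I => h (s : Set (S → Ω)))
          · rw [hBU]
            simp only [hCe]
            rw [I.equivFin.symm.surjective.iUnion_comp (fun s : I => (s : Set (S → Ω)))]
            exact sUnion_eq_iUnion
          · intro i j hij
            rw [hCe, hCe]
            refine hd (I.equivFin.symm i).2 (I.equivFin.symm j).2 ?_
            intro he
            exact hij (I.equivFin.symm.injective (Subtype.ext he)) }
    have hσ : m.IsSigmaSubadditive := cp_sigma lam m hmarg
    refine ⟨m.measure cp_semiring hgen.le hσ, fun B hB => ?_⟩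
    exact m.measure_eq cp_semiring hgen hσ (cp_mem B hB)
end

section
/- Let (Ω, 𝒜, λ) be a probability space, S a finite set, and μ a self-coupling of λ indexed by S. Let A, B, C ⊆ S satisfy A ⊥_μ B, (A∩B) ⊥_μ C, (A∪B) ⊥_μ C, and B ∩ C ⊆ A. Then B ⊥_μ C, A ⊥_μ (B∪C), and (A∪C) ⊥_μ B. -/
open MeasureTheory Set

/-- Two σ-algebras agree up to `μ`-null sets: every set of either one differs from a set
of the other by a `μ`-null set. -/
def EqModNull {α : Type*} {mα : MeasurableSpace α} (μ : Measure α)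
    (B0 B1 : MeasurableSpace α) : Prop :=
  (∀ s, MeasurableSet[B0] s → ∃ t, MeasurableSet[B1] t ∧ μ (symmDiff s t) = 0) ∧
  (∀ s, MeasurableSet[B1] s → ∃ t, MeasurableSet[B0] t ∧ μ (symmDiff s t) = 0)

/-- The sub-σ-algebra `𝒜^S_T` of the product σ-algebra on `ι → Ω`:
preimages under the projection to coordinates in `T` of product-measurable sets. -/
def cylinderAlg {Ω : Type*} (ι : Type*) [MeasurableSpace Ω] (T : Set ι) :
    MeasurableSpace (ι → Ω) :=
  MeasurableSpace.comap (fun ω => T.restrict ω) MeasurableSpace.pi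

/-- The relation `T₁ ⊥_μ T₂` for index sets of a self-coupling: the coordinate
σ-algebras `𝒜^S_{T₁}` and `𝒜^S_{T₂}` are conditionally independent relative to their
meet, and moreover this meet agrees with `𝒜^S_{T₁ ∩ T₂}` up to `μ`-null sets. -/
def BotRel {Ω ι : Type*} [MeasurableSpace Ω] (μ : Measure (ι → Ω)) (T1 T2 : Set ι) : Prop :=
  CondIndepRel μ (cylinderAlg ι T1) (cylinderAlg ι T2)
      (meetAlg μ (cylinderAlg ι T1) (cylinderAlg ι T2)) ∧
  EqModNull μ (meetAlg μ (cylinderAlg ι T1) (cylinderAlg ι T2)) (cylinderAlg ι (T1 ∩ T2))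


section Aux

variable {α : Type*} {mα : MeasurableSpace α} {μ : Measure α}

/-- Bounded and measurable with respect to `m`. -/
def BM (m : MeasurableSpace α) (f : α → ℝ) : Prop :=
  Measurable[m] f ∧ ∃ C, ∀ x, |f x| ≤ C

theorem BM.mono {m m' : MeasurableSpace α} {f : α → ℝ} (h : BM m f) (hm : m ≤ m') : BM m' f :=
  ⟨h.1.mono hm le_rfl, h.2⟩

theorem BM.mul {m : MeasurableSpace α} {f g : α → ℝ} (hf : BM m f) (hg : BM m g) :
    BM m (fun x => f x * g x) := by
  obtain ⟨hf1, C, hC⟩ := hf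
  obtain ⟨hg1, D, hD⟩ := hg
  refine ⟨hf1.mul hg1, C * D, fun x => ?_⟩
  rw [abs_mul]
  exact mul_le_mul (hC x) (hD x) (abs_nonneg _) ((abs_nonneg _).trans (hC x))

theorem BM.ind {m : MeasurableSpace α} {s : Set α} (hs : MeasurableSet[m] s) :
    BM m (s.indicator (fun _ => (1 : ℝ))) := by
  refine ⟨measurable_const.indicator hs, 1, fun x => ?_⟩
  by_cases h : x ∈ s <;> simp [h]

theorem BM.integrable [IsFiniteMeasure μ] {m : MeasurableSpace α} {f : α → ℝ} (hf : BM m f)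
    (hm : m ≤ mα) : Integrable f μ := by
  obtain ⟨hf1, C, hC⟩ := hf
  exact Integrable.of_bound ((hf1.mono hm le_rfl).aestronglyMeasurable) C
    (Filter.Eventually.of_forall fun x => by simpa using hC x)

theorem BM.rep [IsFiniteMeasure μ] {m D : MeasurableSpace α} {f : α → ℝ} (hf : BM m f) :
    ∃ g, BM D g ∧ g =ᵐ[μ] μ[f|D] := by
  obtain ⟨hf1, C, hC⟩ := hf
  have hC0 : ∀ x, |f x| ≤ max C 0 := fun x => (hC x).trans (le_max_left _ _)
  have hb : ∀ᵐ x ∂μ, |(μ[f|D]) x| ≤ ((max C 0).toNNReal : ℝ) := by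
    refine ae_bdd_condExp_of_ae_bdd (Filter.Eventually.of_forall fun x => ?_)
    rw [Real.coe_toNNReal _ (le_max_right _ _)]
    exact hC0 x
  rw [Real.coe_toNNReal _ (le_max_right _ _)] at hb
  refine ⟨fun x => max (-(max C 0)) (min (max C 0) ((μ[f|D]) x)), ⟨?_, max C 0, fun x => ?_⟩, ?_⟩
  · have : Measurable[D] (μ[f|D]) := stronglyMeasurable_condExp.measurable
    exact measurable_const.max (measurable_const.min this)
  · have h0 : 0 ≤ max C 0 := le_max_right _ _
    rw [abs_le]
    exact ⟨le_max_left _ _, max_le (by linarith) (min_le_left _ _)⟩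
  · filter_upwards [hb] with x hx
    rw [abs_le] at hx
    rw [min_eq_right hx.2, max_eq_right hx.1]

/-- Testing a conditional expectation. -/
theorem integral_rep [IsFiniteMeasure μ] {m D : MeasurableSpace α} (hm : m ≤ mα) (hD : D ≤ mα)
    {f φ h : α → ℝ} (hf : BM m f) (hh : BM D h) (hφ : φ =ᵐ[μ] μ[f|D]) :
    ∫ x, f x * h x ∂μ = ∫ x, φ x * h x ∂μ := by
  have h1 : μ[fun x => f x * h x|D] =ᵐ[μ] fun x => (μ[f|D]) x * h x :=
    condExp_mul_of_stronglyMeasurable_right hh.1.stronglyMeasurable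
      (((hf.mono hm).mul (hh.mono hD)).integrable le_rfl) (hf.integrable hm)
  rw [← integral_condExp hD]
  refine integral_congr_ae (h1.trans ?_)
  filter_upwards [hφ] with x hx
  rw [hx]

/-- Weak form of conditional independence of `m1`, `m2` over `D`. -/
def WInd (μ : Measure α) (m1 m2 D : MeasurableSpace α) : Prop :=
  ∀ f g φ : α → ℝ, BM m1 f → BM m2 g → BM D φ → φ =ᵐ[μ] μ[f|D] →
    ∫ x, f x * g x ∂μ = ∫ x, φ x * g x ∂μ

theorem WInd.symm [IsFiniteMeasure μ] {m1 m2 D : MeasurableSpace α} (h1 : m1 ≤ mα) (h2 : m2 ≤ mα)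
    (hD : D ≤ mα) (h : WInd μ m1 m2 D) : WInd μ m2 m1 D := by
  intro g f ψ hg hf hψ hψe
  obtain ⟨φ, hφ, hφe⟩ := hf.rep (μ := μ) (D := D)
  have e1 := h f g φ hf hg hφ hφe
  have e2 := integral_rep h2 hD hg hφ hψe
  have e3 := integral_rep h1 hD hf hψ hφe
  simp only [mul_comm] at *
  simp_all

theorem ind_congr {s t : Set α} (h : s =ᵐ[μ] t) :
    s.indicator (fun _ => (1 : ℝ)) =ᵐ[μ] t.indicator (fun _ => (1 : ℝ)) :=
  indicator_ae_eq_of_ae_eq_set h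

theorem set_eq_mul {s : Set α} (hs : MeasurableSet s) (f : α → ℝ) :
    ∫ x in s, f x ∂μ = ∫ x, f x * s.indicator (fun _ => (1 : ℝ)) x ∂μ := by
  rw [← integral_indicator hs]
  congr 1
  ext x
  by_cases h : x ∈ s <;> simp [h]

theorem ae_eq_of_sets [IsFiniteMeasure μ] {m m1 D : MeasurableSpace α} (hm : m ≤ mα)
    (h1 : m1 ≤ mα) (hDm : D ≤ m) {f φ : α → ℝ} (hf : BM m1 f) (hφ : BM D φ)
    (h : ∀ s, MeasurableSet[m] s → ∫ x in s, f x ∂μ = ∫ x in s, φ x ∂μ) :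
    φ =ᵐ[μ] μ[f|m] := by
  refine ae_eq_condExp_of_forall_setIntegral_eq hm (hf.integrable h1)
    (fun s _ _ => (hφ.integrable (hDm.trans hm)).integrableOn) (fun s hs _ => (h s hs).symm) ?_
  exact (hφ.1.mono hDm le_rfl).stronglyMeasurable.aestronglyMeasurable

theorem WInd.ae_eq [IsFiniteMeasure μ] {m1 m2 D : MeasurableSpace α} (h1 : m1 ≤ mα) (h2 : m2 ≤ mα)
    (hD2 : D ≤ m2) (h : WInd μ m1 m2 D) {f : α → ℝ} (hf : BM m1 f) :
    μ[f|m2] =ᵐ[μ] μ[f|D] := by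
  obtain ⟨φ, hφ, hφe⟩ := hf.rep (μ := μ) (D := D)
  refine (ae_eq_of_sets h2 h1 hD2 hf hφ fun s hs => ?_).symm.trans hφe
  rw [set_eq_mul (h2 _ hs), set_eq_mul (h2 _ hs)]
  exact h f _ φ hf (BM.ind hs) hφ hφe

theorem sup_eq_gen (m2 m3 : MeasurableSpace α) :
    m2 ⊔ m3 = MeasurableSpace.generateFrom
      {s | ∃ b c, MeasurableSet[m2] b ∧ MeasurableSet[m3] c ∧ s = b ∩ c} := by
  apply le_antisymm
  · refine sup_le (fun b hb => ?_) (fun c hc => ?_)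
    · exact MeasurableSpace.measurableSet_generateFrom ⟨b, univ, hb, MeasurableSet.univ, by simp⟩
    · exact MeasurableSpace.measurableSet_generateFrom ⟨univ, c, MeasurableSet.univ, hc, by simp⟩
  · refine MeasurableSpace.generateFrom_le ?_
    rintro s ⟨b, c, hb, hc, rfl⟩
    have hb' : MeasurableSet[m2 ⊔ m3] b := (le_sup_left : m2 ≤ m2 ⊔ m3) _ hb
    have hc' : MeasurableSet[m2 ⊔ m3] c := (le_sup_right : m3 ≤ m2 ⊔ m3) _ hc
    exact MeasurableSet.inter hb' hc'

theorem WInd.of_sup [IsFiniteMeasure μ] {m1 m2 m3 D : MeasurableSpace α} (h1 : m1 ≤ mα)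
    (h2 : m2 ≤ mα) (h3 : m3 ≤ mα) (hD : D ≤ m2 ⊔ m3)
    (h : ∀ f φ b c, BM m1 f → BM m2 b → BM m3 c → BM D φ → φ =ᵐ[μ] μ[f|D] →
      ∫ x, f x * (b x * c x) ∂μ = ∫ x, φ x * (b x * c x) ∂μ) :
    WInd μ m1 (m2 ⊔ m3) D := by
  intro f g φ hf hg hφ hφe
  have hle : m2 ⊔ m3 ≤ mα := sup_le h2 h3
  have hfi : Integrable f μ := hf.integrable h1
  have hφi : Integrable φ μ := hφ.integrable (hD.trans hle)
  have hbase : ∀ b c, MeasurableSet[m2] b → MeasurableSet[m3] c →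
      ∫ x in b ∩ c, f x ∂μ = ∫ x in b ∩ c, φ x ∂μ := by
    intro b c hb hc
    have := h f φ _ _ hf (BM.ind hb) (BM.ind hc) hφ hφe
    have hbc : MeasurableSet[mα] (b ∩ c) := MeasurableSet.inter (h2 _ hb) (h3 _ hc)
    rw [set_eq_mul hbc, set_eq_mul hbc]
    have e : ∀ x, b.indicator (fun _ => (1 : ℝ)) x * c.indicator (fun _ => (1 : ℝ)) x
        = (b ∩ c).indicator (fun _ => (1 : ℝ)) x := by
      intro x
      by_cases hxb : x ∈ b <;> by_cases hxc : x ∈ c <;> simp [hxb, hxc]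
    simpa only [e] using this
  have huniv : ∫ x, f x ∂μ = ∫ x, φ x ∂μ := by
    simpa using hbase univ univ MeasurableSet.univ MeasurableSet.univ
  have hsets : ∀ s, MeasurableSet[m2 ⊔ m3] s → ∫ x in s, f x ∂μ = ∫ x in s, φ x ∂μ := by
    intro s hs
    induction s, hs using MeasurableSpace.induction_on_inter (sup_eq_gen m2 m3) with
    | h_inter =>
      rintro _ ⟨b, c, hb, hc, rfl⟩ _ ⟨b', c', hb', hc', rfl⟩ -
      exact ⟨b ∩ b', c ∩ c', MeasurableSet.inter hb hb', MeasurableSet.inter hc hc',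
        Set.inter_inter_inter_comm _ _ _ _⟩
    | empty => simp
    | basic t ht =>
      obtain ⟨b, c, hb, hc, rfl⟩ := ht
      exact hbase b c hb hc
    | compl t ht ih =>
      rw [setIntegral_compl (hle _ ht) hfi, setIntegral_compl (hle _ ht) hφi, ih, huniv]
    | iUnion t hd ht ih =>
      rw [integral_iUnion (fun i => hle _ (ht i)) hd hfi.integrableOn,
        integral_iUnion (fun i => hle _ (ht i)) hd hφi.integrableOn]
      simp only [ih]
  exact integral_rep h1 hle hf hg (ae_eq_of_sets hle h1 hD hf hφ hsets)

theorem meetAlg_le {m1 m2 : MeasurableSpace α} : meetAlg μ m1 m2 ≤ mα := fun _ hs => hs.1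

theorem le_meetAlg {m1 m2 D : MeasurableSpace α} (h1 : m1 ≤ mα) (hD1 : D ≤ m1) (hD2 : D ≤ m2) :
    D ≤ meetAlg μ m1 m2 := fun s hs =>
  ⟨h1 _ (hD1 _ hs), ⟨s, hD1 _ hs, by simp⟩, ⟨s, hD2 _ hs, by simp⟩⟩

theorem condExp_meet [IsFiniteMeasure μ] {M D m : MeasurableSpace α} (hM : M ≤ mα) (hDM : D ≤ M)
    (hm : m ≤ mα)
    (hE : ∀ s, MeasurableSet[M] s → ∃ t, MeasurableSet[D] t ∧ μ (symmDiff s t) = 0)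
    {f : α → ℝ} (hf : BM m f) : μ[f|M] =ᵐ[μ] μ[f|D] := by
  obtain ⟨φ, hφ, hφe⟩ := hf.rep (μ := μ) (D := D)
  refine (ae_eq_of_sets hM hm hDM hf hφ fun s hs => ?_).symm.trans hφe
  obtain ⟨t, ht, hst⟩ := hE s hs
  have hst' : s =ᵐ[μ] t := measure_symmDiff_eq_zero_iff.1 hst
  rw [setIntegral_congr_set hst', setIntegral_congr_set hst']
  have htm : MeasurableSet[mα] t := hM _ (hDM _ ht)
  rw [set_eq_mul htm, set_eq_mul htm]
  exact integral_rep hm (hDM.trans hM) hf (BM.ind ht) hφe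

theorem WInd.iff [IsFiniteMeasure μ] {m1 m2 D : MeasurableSpace α} (h1 : m1 ≤ mα) (h2 : m2 ≤ mα)
    (hD1 : D ≤ m1) (hD2 : D ≤ m2) :
    (CondIndepRel μ m1 m2 (meetAlg μ m1 m2) ∧ EqModNull μ (meetAlg μ m1 m2) D) ↔
      WInd μ m1 m2 D := by
  have hM : meetAlg μ m1 m2 ≤ mα := meetAlg_le
  have hDM : D ≤ meetAlg μ m1 m2 := le_meetAlg h1 hD1 hD2
  have hD : D ≤ mα := hDM.trans hM
  constructor
  · rintro ⟨hc, hE, -⟩ f g φ hf hg hφ hφe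
    obtain ⟨ψ, hψ, hψe⟩ := hg.rep (μ := μ) (D := D)
    have e := hc f g hf.1 hg.1 hf.2 hg.2
    have ef := condExp_meet hM hDM h1 hE hf
    have eg := condExp_meet hM hDM h2 hE hg
    have e2 := integral_rep h2 hD hg hφ hψe
    rw [← integral_condExp hM, integral_congr_ae e]
    calc _ = ∫ x, ψ x * φ x ∂μ := by
          refine integral_congr_ae ?_
          filter_upwards [ef, eg, hφe, hψe] with x a1 a2 a3 a4
          rw [a1, a2, a3, a4, mul_comm]
      _ = _ := by rw [← e2]; simp only [mul_comm]
  · intro h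
    have hE : ∀ s, MeasurableSet[meetAlg μ m1 m2] s →
        ∃ t, MeasurableSet[D] t ∧ μ (symmDiff s t) = 0 := by
      rintro s ⟨hs, ⟨b0, hb0, e0⟩, ⟨b1, hb1, e1⟩⟩
      have e0' : s =ᵐ[μ] b0 := measure_symmDiff_eq_zero_iff.1 e0
      have e1' : s =ᵐ[μ] b1 := measure_symmDiff_eq_zero_iff.1 e1
      have e01 : b0 =ᵐ[μ] b1 := e0'.symm.trans e1'
      obtain ⟨φ, hφ, hφe⟩ := (BM.ind hb0).rep (μ := μ) (D := D)
      have k1 := h.ae_eq h1 h2 hD2 (BM.ind hb0)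
      have k2 : μ[b0.indicator (fun _ => (1 : ℝ))|m2] =ᵐ[μ] b1.indicator (fun _ => (1 : ℝ)) := by
        refine (condExp_congr_ae (ind_congr e01)).trans ?_
        rw [condExp_of_stronglyMeasurable h2 (BM.ind hb1).1.stronglyMeasurable
          ((BM.ind hb1).integrable h2)]
      refine ⟨φ ⁻¹' {1}, hφ.1 (measurableSet_singleton 1), measure_symmDiff_eq_zero_iff.2 ?_⟩
      refine e1'.trans ?_
      filter_upwards [k1, k2, hφe] with x a1 a2 a3
      have : φ x = b1.indicator (fun _ => (1 : ℝ)) x := by rw [a3, ← a1, a2]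
      apply propext
      change x ∈ b1 ↔ φ x = 1
      rw [this]
      by_cases hx : x ∈ b1 <;> simp [hx]
    refine ⟨?_, hE, fun s hs => ⟨s, hDM _ hs, by simp⟩⟩
    intro f g hf1 hg1 hf2 hg2
    have hf : BM m1 f := ⟨hf1, hf2⟩
    have hg : BM m2 g := ⟨hg1, hg2⟩
    have ef := condExp_meet hM hDM h1 hE hf
    have eg := condExp_meet hM hDM h2 hE hg
    have hfg : BM mα (fun x => f x * g x) := (hf.mono h1).mul (hg.mono h2)
    have efg := condExp_meet hM hDM le_rfl hE hfg
    obtain ⟨φ, hφ, hφe⟩ := hf.rep (μ := μ) (D := D)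
    obtain ⟨ψ, hψ, hψe⟩ := hg.rep (μ := μ) (D := D)
    have key : (fun x => φ x * ψ x) =ᵐ[μ] μ[fun x => f x * g x|D] := by
      refine ae_eq_of_sets hD le_rfl le_rfl hfg (hφ.mul hψ) fun s hs => ?_
      rw [set_eq_mul (hD _ hs), set_eq_mul (hD _ hs)]
      have a1 := h f _ φ hf (hg.mul (BM.ind (hD2 _ hs))) hφ hφe
      have a2 := integral_rep h2 hD hg (hφ.mul (BM.ind hs)) hψe
      simp only [mul_assoc]
      rw [a1]
      calc _ = _ := by
            refine integral_congr_ae (Filter.Eventually.of_forall fun x => ?_)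
            exact mul_left_comm _ _ _
        _ = _ := a2
        _ = _ := by
            refine integral_congr_ae (Filter.Eventually.of_forall fun x => ?_)
            exact mul_left_comm _ _ _
    filter_upwards [efg, key, ef, eg, hφe, hψe] with x a1 a2 a3 a4 a5 a6
    rw [a1, ← a2, a3, a4, a5, a6]

end Aux

theorem cylinderAlg_eq {Ω : Type*} (ι : Type*) [MeasurableSpace Ω] (T : Set ι) :
    cylinderAlg (Ω := Ω) ι T =
      ⨆ i ∈ T, MeasurableSpace.comap (fun ω : ι → Ω => ω i) inferInstance := by
  unfold cylinderAlg MeasurableSpace.pi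
  rw [MeasurableSpace.comap_iSup, iSup_subtype']
  congr 1
  ext i : 1
  rw [MeasurableSpace.comap_comp]
  rfl

theorem cylinderAlg_mono {Ω ι : Type*} [MeasurableSpace Ω] {T T' : Set ι} (h : T ⊆ T') :
    cylinderAlg (Ω := Ω) ι T ≤ cylinderAlg ι T' := by
  rw [cylinderAlg_eq, cylinderAlg_eq]
  exact biSup_mono h

theorem cylinderAlg_union {Ω ι : Type*} [MeasurableSpace Ω] (T T' : Set ι) :
    cylinderAlg (Ω := Ω) ι (T ∪ T') = cylinderAlg ι T ⊔ cylinderAlg ι T' := by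
  simp only [cylinderAlg_eq, iSup_union]

theorem cylinderAlg_le {Ω ι : Type*} [MeasurableSpace Ω] (T : Set ι) :
    cylinderAlg (Ω := Ω) ι T ≤ MeasurableSpace.pi := by
  rw [cylinderAlg_eq]
  exact iSup₂_le fun i _ => (measurable_pi_apply i).comap_le

theorem botRel_iff {Ω ι : Type*} [MeasurableSpace Ω] (μ : Measure (ι → Ω)) [IsFiniteMeasure μ]
    (T1 T2 : Set ι) :
    BotRel μ T1 T2 ↔
      WInd μ (cylinderAlg ι T1) (cylinderAlg ι T2) (cylinderAlg ι (T1 ∩ T2)) :=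
  WInd.iff (cylinderAlg_le _) (cylinderAlg_le _) (cylinderAlg_mono inter_subset_left)
    (cylinderAlg_mono inter_subset_right)

theorem botRel_three_aux {Ω ι : Type*} [MeasurableSpace Ω] (μ : Measure (ι → Ω))
    [IsFiniteMeasure μ] (A B C : Set ι)
    (hAB : BotRel μ A B) (hABC : BotRel μ (A ∩ B) C) (hABC' : BotRel μ (A ∪ B) C)
    (hBCA : B ∩ C ⊆ A) :
    BotRel μ B C ∧ BotRel μ A (B ∪ C) ∧ BotRel μ (A ∪ C) B := by
  rw [botRel_iff] at hAB hABC hABC'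
  rw [botRel_iff, botRel_iff, botRel_iff]
  have e1 : (A ∪ B) ∩ C = A ∩ C := by
    ext x; have := @hBCA x; simp only [mem_inter_iff, mem_union] at *; tauto
  have e2 : A ∩ B ∩ C = B ∩ C := by
    ext x; have := @hBCA x; simp only [mem_inter_iff] at *; tauto
  have e3 : (A ∪ C) ∩ B = A ∩ B := by
    ext x; have := @hBCA x; simp only [mem_inter_iff, mem_union] at *; tauto
  rw [e1] at hABC'
  rw [e2] at hABC
  rw [e3]
  have le := fun T : Set ι => cylinderAlg_le (Ω := Ω) T
  have hBA := hAB.symm (le _) (le _) (le _)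
  have hC1 := hABC.symm (le _) (le _) (le _)
  have hC2 := hABC'.symm (le _) (le _) (le _)
  refine ⟨WInd.symm (le _) (le _) (le _) ?_, ?_, WInd.symm (le _) (le _) (le _) ?_⟩
  · intro f g ε hf hg hε hεe
    obtain ⟨γ, hγ, hγe⟩ := hf.rep (μ := μ) (D := cylinderAlg ι (A ∩ C))
    obtain ⟨δ, hδ, hδe⟩ := hg.rep (μ := μ) (D := cylinderAlg ι (A ∩ B))
    have a1 := hC2 f g γ hf (hg.mono (cylinderAlg_mono subset_union_right)) hγ hγe
    have a2 := hBA g γ δ hg (hγ.mono (cylinderAlg_mono inter_subset_left)) hδ hδe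
    have a3 := hC2 f δ γ hf (hδ.mono (cylinderAlg_mono
      (inter_subset_left.trans subset_union_left))) hγ hγe
    have a4 := hC1 f δ ε hf hδ hε hεe
    have a5 := integral_rep (le _) (le _) hg (hε.mono (cylinderAlg_mono
      (subset_inter hBCA inter_subset_left))) hδe
    rw [a1]
    simp only [mul_comm] at *
    simp_all
  · rw [cylinderAlg_union]
    have hDle : cylinderAlg (Ω := Ω) ι (A ∩ (B ∪ C)) ≤ cylinderAlg ι A :=
      cylinderAlg_mono inter_subset_left
    refine WInd.of_sup (le _) (le _) (le _) ?_ ?_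
    · rw [← cylinderAlg_union]; exact cylinderAlg_mono inter_subset_right
    intro f φ b c hf hb hc hφ hφe
    obtain ⟨γ, hγ, hγe⟩ := hc.rep (μ := μ) (D := cylinderAlg ι (A ∩ C))
    obtain ⟨β, hβ, hβe⟩ := hb.rep (μ := μ) (D := cylinderAlg ι (A ∩ B))
    have key : ∀ f, BM (cylinderAlg ι A) f →
        ∫ x, f x * (b x * c x) ∂μ = ∫ x, f x * (β x * γ x) ∂μ := by
      intro f hf
      have a1 := hC2 c _ γ hc ((hf.mono (cylinderAlg_mono subset_union_left)).mul
        (hb.mono (cylinderAlg_mono subset_union_right))) hγ hγe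
      have a2 := hBA b _ β hb (hf.mul (hγ.mono (cylinderAlg_mono inter_subset_left))) hβ hβe
      calc _ = ∫ x, c x * (f x * b x) ∂μ := by congr 1; ext x; ring
        _ = _ := a1
        _ = ∫ x, b x * (f x * γ x) ∂μ := by congr 1; ext x; ring
        _ = _ := a2
        _ = _ := by congr 1; ext x; ring
    rw [key f hf, key φ (hφ.mono hDle)]
    refine integral_rep (le _) (le _) hf (BM.mul ?_ ?_) hφe
    · exact hβ.mono (cylinderAlg_mono (inter_subset_inter_right _ subset_union_left))
    · exact hγ.mono (cylinderAlg_mono (inter_subset_inter_right _ subset_union_right))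
  · rw [cylinderAlg_union]
    refine WInd.of_sup (le _) (le _) (le _)
      ((cylinderAlg_mono inter_subset_left).trans le_sup_left) ?_
    intro f φ a c hf ha hc hφ hφe
    obtain ⟨γ, hγ, hγe⟩ := hc.rep (μ := μ) (D := cylinderAlg ι (A ∩ C))
    have key : ∀ f, BM (cylinderAlg ι B) f →
        ∫ x, f x * (a x * c x) ∂μ = ∫ x, f x * (a x * γ x) ∂μ := by
      intro f hf
      have a1 := hC2 c _ γ hc ((hf.mono (cylinderAlg_mono subset_union_right)).mul
        (ha.mono (cylinderAlg_mono subset_union_left))) hγ hγe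
      calc _ = ∫ x, c x * (f x * a x) ∂μ := by congr 1; ext x; ring
        _ = _ := a1
        _ = _ := by congr 1; ext x; ring
    rw [key f hf, key φ (hφ.mono (cylinderAlg_mono inter_subset_right))]
    exact hBA f _ φ hf (ha.mul (hγ.mono (cylinderAlg_mono inter_subset_left))) hφ hφe

/-- **Three-set lemma for the conditional-independence relation `⊥_μ`** (Lemma 2.30).
If `A ⊥_μ B`, `(A ∩ B) ⊥_μ C`, `(A ∪ B) ⊥_μ C` and `B ∩ C ⊆ A`, then
`B ⊥_μ C`, `A ⊥_μ (B ∪ C)` and `(A ∪ C) ⊥_μ B`. -/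
theorem botRel_three_sets
    {Ω : Type*} [mΩ : MeasurableSpace Ω] (lam : Measure Ω) [IsProbabilityMeasure lam]
    {S : Type*} [Fintype S]
    (μ : Measure (S → Ω)) (hcoup : ∀ v : S, μ.map (fun ω => ω v) = lam)
    (A B C : Set S)
    (hAB : BotRel μ A B) (hABC : BotRel μ (A ∩ B) C) (hABC' : BotRel μ (A ∪ B) C)
    (hBCA : B ∩ C ⊆ A) :
    BotRel μ B C ∧ BotRel μ A (B ∪ C) ∧ BotRel μ (A ∪ C) B := by
  rcases isEmpty_or_nonempty S with hS | ⟨⟨v⟩⟩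
  · have hA : A = ∅ := Set.eq_empty_of_isEmpty A
    have hB : B = ∅ := Set.eq_empty_of_isEmpty B
    have hC : C = ∅ := Set.eq_empty_of_isEmpty C
    subst hA hB hC
    simpa using hAB
  · have hfin : IsFiniteMeasure μ := by
      refine ⟨?_⟩
      have h := congrArg (fun m => m univ) (hcoup v)
      simp only [measure_univ] at h
      rw [Measure.map_apply (measurable_pi_apply v) MeasurableSet.univ, preimage_univ] at h
      rw [h]
      exact ENNReal.one_lt_top
    exact botRel_three_aux μ A B C hAB hABC hABC' hBCA
end

section
/- Let (Ω, 𝒜, λ) be a probability space, S a finite set, μ a self-coupling of λ indexed by S, and Λ a set lattice in S, i.e. a family of subsets of S closed under unions and intersections. Say that T ∈ Λ has the CIS property in Λ if T₁ ⊥_μ T₂ holds for all T₁, T₂ ∈ Λ with T₁, T₂ ⊆ T. If T₁, T₂ ∈ Λ both have the CIS property in Λ and T₁ ⊥_μ T₂, then T₁ ∪ T₂ has the CIS property in Λ. -/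
open MeasureTheory Set

/-- A set `T` of a set lattice `Λ` in `S` has the conditional independence of subsets
(CIS) property in `Λ` (with respect to the coupling `μ`) if any two members of `Λ`
contained in `T` satisfy `⊥_μ`. -/
def HasCIS {Ω S : Type*} [MeasurableSpace Ω] (μ : Measure (S → Ω))
    (Lambda : Set (Set S)) (T : Set S) : Prop :=
  ∀ T1 ∈ Lambda, ∀ T2 ∈ Lambda, T1 ⊆ T → T2 ⊆ T → BotRel μ T1 T2


section CISProof

open Filter ProbabilityTheory

/-- Conditional expectation given `m2` of any integrable `m1`-measurable function is
a.e. `m`-measurable. -/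
def CISQ {α : Type*} {mα : MeasurableSpace α} (μ : Measure α)
    (m1 m2 m : MeasurableSpace α) : Prop :=
  ∀ f : α → ℝ, Integrable f μ → AEStronglyMeasurable[m1] f μ →
    AEStronglyMeasurable[m] (μ[f|m2]) μ

variable {α : Type*} {mα : MeasurableSpace α} {μ : Measure α} [IsProbabilityMeasure μ]

theorem cisq_closed {m2 m : MeasurableSpace α} (h2 : m2 ≤ mα) (h : m ≤ mα) :
    IsClosed {f : @Lp α ℝ mα _ 1 μ | AEStronglyMeasurable[m] (μ[(f : α → ℝ)|m2]) μ} := by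
  have hc := (isClosed_aestronglyMeasurable (F := ℝ) (p := 1) (μ := μ) h).preimage
      (condExpL1CLM ℝ h2 μ).continuous
  convert hc using 1
  ext g
  have e : μ[(g : α → ℝ)|m2] =ᵐ[μ] condExpL1CLM ℝ h2 μ g := by
    have hi : Integrable (g : α → ℝ) μ :=
      (memLp_one_iff_integrable (m := mα)).1 (Lp.memLp g)
    have := condExp_ae_eq_condExpL1CLM (μ := μ) h2 hi
    rwa [Integrable.toL1_coeFn] at this
  exact ⟨fun h => AEStronglyMeasurable.congr h e, fun h => AEStronglyMeasurable.congr h e.symm⟩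

theorem cisq_ind_ae {s t : Set α} (h : μ (symmDiff s t) = 0) :
    s.indicator (fun _ => (1 : ℝ)) =ᵐ[μ] t.indicator (fun _ => (1 : ℝ)) :=
  indicator_ae_eq_of_ae_eq_set (measure_symmDiff_eq_zero_iff.1 h)

theorem CISQ.of_sets {m1 m2 m : MeasurableSpace α} (h1 : m1 ≤ mα) (h2 : m2 ≤ mα) (h : m ≤ mα)
    (H : ∀ s, MeasurableSet[m1] s →
      AEStronglyMeasurable[m] (μ[s.indicator (fun _ => (1 : ℝ))|m2]) μ) :
    CISQ μ m1 m2 m := by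
  intro f hf hfm
  refine MemLp.induction_stronglyMeasurable (p := 1) h1 (by simp)
    (fun f => AEStronglyMeasurable[m] (μ[f|m2]) μ) ?_ ?_ ?_ ?_ (memLp_one_iff_integrable.2 hf) hfm
  · intro c s hs _
    have e : (s.indicator fun _ => c) = c • (s.indicator (fun _ => (1 : ℝ))) := by
      ext x
      by_cases hx : x ∈ s <;> simp [hx]
    rw [e]
    exact ((H s hs).const_smul c).congr (condExp_smul c _ m2).symm
  · intro f g _ hf hg _ _ Hf Hg
    exact (Hf.add Hg).congr
      (condExp_add (memLp_one_iff_integrable.1 hf) (memLp_one_iff_integrable.1 hg) m2).symm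
  · exact (cisq_closed h2 h).preimage continuous_subtype_val
  · intro f g hfg _ h
    exact h.congr (condExp_congr_ae hfg)

theorem cisq_ind_int {s : Set α} (hs : MeasurableSet s) :
    Integrable (s.indicator (fun _ => (1 : ℝ))) μ :=
  (integrable_const 1).indicator hs

theorem CISQ.of_sup {m1 m1' m2 m : MeasurableSpace α} (h1 : m1 ≤ mα) (h1' : m1' ≤ mα)
    (h2 : m2 ≤ mα) (h : m ≤ mα)
    (H : ∀ s t, MeasurableSet[m1] s → MeasurableSet[m1'] t →
      AEStronglyMeasurable[m] (μ[(s ∩ t).indicator (fun _ => (1 : ℝ))|m2]) μ) :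
    CISQ μ (m1 ⊔ m1') m2 m := by
  refine CISQ.of_sets (sup_le h1 h1') h2 h ?_
  have hgen : m1 ⊔ m1' = MeasurableSpace.generateFrom
      (image2 (· ∩ ·) {s | MeasurableSet[m1] s} {t | MeasurableSet[m1'] t}) := by
    apply le_antisymm
    · refine sup_le ?_ ?_
      · intro s hs
        exact MeasurableSpace.measurableSet_generateFrom
          ⟨s, hs, univ, @MeasurableSet.univ _ m1', by simp⟩
      · intro s hs
        exact MeasurableSpace.measurableSet_generateFrom
          ⟨univ, @MeasurableSet.univ _ m1, s, hs, by simp⟩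
    · refine MeasurableSpace.generateFrom_le ?_
      rintro _ ⟨s, hs, t, ht, rfl⟩
      exact @MeasurableSet.inter _ (m1 ⊔ m1') _ _ ((le_sup_left : m1 ≤ m1 ⊔ m1') _ hs)
        ((le_sup_right : m1' ≤ m1 ⊔ m1') _ ht)
  have hpi : IsPiSystem
      (image2 (· ∩ ·) {s | MeasurableSet[m1] s} {t | MeasurableSet[m1'] t}) := by
    rintro _ ⟨s, hs, t, ht, rfl⟩ _ ⟨s', hs', t', ht', rfl⟩ _
    exact ⟨s ∩ s', @MeasurableSet.inter _ m1 _ _ hs hs', t ∩ t',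
      @MeasurableSet.inter _ m1' _ _ ht ht', by
        ext x; simp only [mem_inter_iff]; tauto⟩
  have hle : m1 ⊔ m1' ≤ mα := sup_le h1 h1'
  intro s hs
  refine MeasurableSpace.induction_on_inter (m := m1 ⊔ m1')
    (C := fun s _ => AEStronglyMeasurable[m] (μ[s.indicator (fun _ => (1 : ℝ))|m2]) μ)
    hgen hpi ?_ ?_ ?_ ?_ s hs
  · simp only [indicator_empty]
    have : μ[(fun _ => (0 : ℝ))|m2] = 0 := condExp_zero
    rw [this]
    exact (@stronglyMeasurable_zero _ _ m _ _).aestronglyMeasurable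
  · rintro _ ⟨s, hs, t, ht, rfl⟩
    exact H s t hs ht
  · intro t ht hC
    have e : tᶜ.indicator (fun _ => (1 : ℝ)) =
        (fun _ => (1 : ℝ)) - t.indicator (fun _ => (1 : ℝ)) := by
      ext x; by_cases hx : x ∈ t <;> simp [hx]
    rw [e]
    refine AEStronglyMeasurable.congr ?_
      (condExp_sub (integrable_const 1) (cisq_ind_int (hle _ ht)) m2).symm
    rw [condExp_const h2]
    exact (@stronglyMeasurable_const _ _ m _ _).aestronglyMeasurable.sub hC
  · intro f hd hfm hC
    have hacc : ∀ n, AEStronglyMeasurable[m]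
        (μ[(accumulate f n).indicator (fun _ => (1 : ℝ))|m2]) μ := by
      intro n
      induction n with
      | zero => simpa using hC 0
      | succ n ih =>
        have e : (accumulate f (n + 1)).indicator (fun _ => (1 : ℝ)) =
            (accumulate f n).indicator (fun _ => (1 : ℝ))
              + (f (n + 1)).indicator (fun _ => (1 : ℝ)) := by
          rw [accumulate_succ]
          exact indicator_union_of_disjoint (disjoint_accumulate hd (Nat.lt_succ_self n)) _
        rw [e]
        refine (ih.add (hC (n + 1))).congr (condExp_add (cisq_ind_int ?_)
          (cisq_ind_int (hle _ (hfm _))) m2).symm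
        exact MeasurableSet.biUnion (to_countable _) fun i _ => hle _ (hfm i)
    have hmeas : ∀ n, MeasurableSet[mα] (accumulate f n) := fun n =>
      MeasurableSet.biUnion (to_countable _) fun i _ => hle _ (hfm i)
    have ht := tendsto_condExpL1_of_dominated_convergence (μ := μ) h2
      (fs := fun n => (accumulate f n).indicator (fun _ => (1 : ℝ)))
      (f := (⋃ i, f i).indicator (fun _ => (1 : ℝ))) (fun _ => 1)
      (fun n => (cisq_ind_int (μ := μ) (hmeas n)).aestronglyMeasurable) (integrable_const 1)
      (fun n => Eventually.of_forall fun x => by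
        by_cases hx : x ∈ accumulate f n <;> simp [hx])
      (Eventually.of_forall fun x => by
        have := (monotone_accumulate (s := f)).tendsto_indicator _ (fun _ => (1 : ℝ)) x
        rw [iUnion_accumulate] at this
        exact this.mono_right (pure_le_nhds _))
    have := (isClosed_aestronglyMeasurable (F := ℝ) (p := 1) (μ := μ) h).mem_of_tendsto ht
      (Eventually.of_forall fun n => (hacc n).congr (condExp_ae_eq_condExpL1 h2 _))
    exact AEStronglyMeasurable.congr this (condExp_ae_eq_condExpL1 h2 _).symm

theorem cisq_ae_of_mod {M m : MeasurableSpace α} (hM : M ≤ mα) (h : m ≤ mα)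
    (H : ∀ s, MeasurableSet[M] s → ∃ t, MeasurableSet[m] t ∧ μ (symmDiff s t) = 0)
    {f : α → ℝ} (hf : Integrable f μ) (hfm : AEStronglyMeasurable[M] f μ) :
    AEStronglyMeasurable[m] f μ := by
  have hQ : CISQ μ M mα m := by
    refine CISQ.of_sets hM le_rfl h fun s hs => ?_
    obtain ⟨t, ht, hst⟩ := H s hs
    have h1 := condExp_of_aestronglyMeasurable' (μ := μ) le_rfl
      (cisq_ind_int (μ := μ) (hM _ hs)).aestronglyMeasurable (cisq_ind_int (μ := μ) (hM _ hs))
    have h2 : s.indicator (fun _ => (1 : ℝ)) =ᵐ[μ] t.indicator (fun _ => (1 : ℝ)) :=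
      cisq_ind_ae hst
    refine AEStronglyMeasurable.congr ?_ (h1.trans h2).symm
    exact ((@stronglyMeasurable_const _ _ m _ _).indicator ht).aestronglyMeasurable
  have h1 := condExp_of_aestronglyMeasurable' (μ := μ) le_rfl hf.aestronglyMeasurable hf
  exact (hQ f hf hfm).congr h1

theorem cisq_meet_le (m1 m2 : MeasurableSpace α) : meetAlg μ m1 m2 ≤ mα := fun _ hs => hs.1

theorem CISQ.condExp_eq {m1 m2 m : MeasurableSpace α} (hQ : CISQ μ m1 m2 m)
    (h2 : m2 ≤ mα) (hm2 : m ≤ m2) {f : α → ℝ} (hf : Integrable f μ)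
    (hfm : AEStronglyMeasurable[m1] f μ) : μ[f|m2] =ᵐ[μ] μ[f|m] :=
  (condExp_of_aestronglyMeasurable' (hm2.trans h2) (hQ f hf hfm) integrable_condExp).symm.trans
    (condExp_condExp_of_le hm2 h2)

theorem cisq_bdd_int {m1 : MeasurableSpace α} (h1 : m1 ≤ mα) {f : α → ℝ}
    (hf : Measurable[m1] f) (hb : ∃ C, ∀ x, |f x| ≤ C) : Integrable f μ := by
  obtain ⟨C, hC⟩ := hb
  exact Integrable.of_bound (hf.mono h1 le_rfl).aestronglyMeasurable C
    (Eventually.of_forall fun x => hC x)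

theorem CISQ.toRel {m1 m2 m : MeasurableSpace α} (hQ : CISQ μ m1 m2 m) (h1 : m1 ≤ mα)
    (h2 : m2 ≤ mα) (hm1 : m ≤ m1) (hm2 : m ≤ m2) :
    CondIndepRel μ m1 m2 (meetAlg μ m1 m2) ∧ EqModNull μ (meetAlg μ m1 m2) m := by
  have hle : m ≤ mα := hm2.trans h2
  have hmM : m ≤ meetAlg μ m1 m2 := fun s hs =>
    ⟨hle _ hs, ⟨s, hm1 _ hs, by simp⟩, ⟨s, hm2 _ hs, by simp⟩⟩
  have hmod : ∀ s, MeasurableSet[meetAlg μ m1 m2] s →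
      ∃ t, MeasurableSet[m] t ∧ μ (symmDiff s t) = 0 := by
    rintro s ⟨hs, ⟨b0, hb0, h0⟩, ⟨b1, hb1, h1'⟩⟩
    have e0 : s.indicator (fun _ => (1 : ℝ)) =ᵐ[μ] b0.indicator (fun _ => (1 : ℝ)) :=
      cisq_ind_ae h0
    have e1 : s.indicator (fun _ => (1 : ℝ)) =ᵐ[μ] b1.indicator (fun _ => (1 : ℝ)) :=
      cisq_ind_ae h1'
    have a0 : AEStronglyMeasurable[m1] (s.indicator (fun _ => (1 : ℝ))) μ :=
      (((@stronglyMeasurable_const _ _ m1 _ _).indicator hb0).aestronglyMeasurable).congr e0.symm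
    have a1 : AEStronglyMeasurable[m2] (s.indicator (fun _ => (1 : ℝ))) μ :=
      (((@stronglyMeasurable_const _ _ m2 _ _).indicator hb1).aestronglyMeasurable).congr e1.symm
    have hi := cisq_ind_int (μ := μ) hs
    have am : AEStronglyMeasurable[m] (s.indicator (fun _ => (1 : ℝ))) μ :=
      (hQ _ hi a0).congr (condExp_of_aestronglyMeasurable' h2 a1 hi)
    obtain ⟨g, hg, hsg⟩ := am
    refine ⟨g ⁻¹' {1}, hg.measurable (measurableSet_singleton 1), ?_⟩
    rw [measure_symmDiff_eq_zero_iff]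
    filter_upwards [hsg] with x hx
    apply propext
    change x ∈ s ↔ g x = 1
    rw [← hx]
    by_cases hxs : x ∈ s <;> simp [hxs]
  refine ⟨?_, hmod, fun s hs => ⟨s, hmM _ hs, by simp⟩⟩
  have hcond : ∀ f : α → ℝ, μ[f|meetAlg μ m1 m2] =ᵐ[μ] μ[f|m] := by
    intro f
    have hML := cisq_meet_le (μ := μ) m1 m2
    exact (condExp_of_aestronglyMeasurable' hle (cisq_ae_of_mod hML hle hmod integrable_condExp
      stronglyMeasurable_condExp.aestronglyMeasurable) integrable_condExp).symm.trans
      (condExp_condExp_of_le hmM hML)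
  intro f0 f1 hf0 hf1 hb0 hb1
  have i0 : Integrable f0 μ := cisq_bdd_int h1 hf0 hb0
  have i1 : Integrable f1 μ := cisq_bdd_int h2 hf1 hb1
  have i01 : Integrable (f0 * f1) μ := by
    obtain ⟨C, hC⟩ := hb1
    exact i0.mul_bdd (c := C) i1.aestronglyMeasurable (Eventually.of_forall fun x => hC x)
  have j01 : Integrable (μ[f0|m] * f1) μ := by
    obtain ⟨C, hC⟩ := hb1
    exact (integrable_condExp (μ := μ) (f := f0)).mul_bdd (c := C) i1.aestronglyMeasurable (Eventually.of_forall fun x => hC x)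
  have k1 : μ[f0 * f1|m2] =ᵐ[μ] μ[f0|m2] * f1 :=
    condExp_mul_of_stronglyMeasurable_right (Measurable.stronglyMeasurable hf1)
      i01 i0
  have k2 : μ[f0|m2] =ᵐ[μ] μ[f0|m] := hQ.condExp_eq h2 hm2 i0
    (Measurable.stronglyMeasurable hf0).aestronglyMeasurable
  have k3 : μ[f0 * f1|m2] =ᵐ[μ] μ[f0|m] * f1 := k1.trans (k2.mul (EventuallyEq.refl _ _))
  have k4 : μ[f0 * f1|m] =ᵐ[μ] μ[f0|m] * μ[f1|m] :=
    (condExp_condExp_of_le hm2 h2).symm.trans ((condExp_congr_ae k3).trans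
      (condExp_mul_of_stronglyMeasurable_left stronglyMeasurable_condExp j01 i1))
  filter_upwards [hcond (f0 * f1), hcond f0, hcond f1, k4] with x a b c d
  rw [b, c]
  exact a.trans d

theorem cisq_of_rel {m1 m2 m : MeasurableSpace α} (h1 : m1 ≤ mα)
    (h2 : m2 ≤ mα) (hm2 : m ≤ m2)
    (hC : CondIndepRel μ m1 m2 (meetAlg μ m1 m2)) (hE : EqModNull μ (meetAlg μ m1 m2) m) :
    CISQ μ m1 m2 m := by
  have hML := cisq_meet_le (μ := μ) m1 m2
  have hle : m ≤ mα := hm2.trans h2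
  refine CISQ.of_sets h1 h2 hle fun s hs => ?_
  have iS := cisq_ind_int (μ := μ) (h1 _ hs)
  have hM2 : AEStronglyMeasurable[m2] (μ[s.indicator (fun _ => (1 : ℝ))|meetAlg μ m1 m2]) μ :=
    cisq_ae_of_mod hML h2 (fun s hs => hs.2.2) integrable_condExp
      stronglyMeasurable_condExp.aestronglyMeasurable
  have hMm : AEStronglyMeasurable[m] (μ[s.indicator (fun _ => (1 : ℝ))|meetAlg μ m1 m2]) μ :=
    cisq_ae_of_mod hML hle hE.1 integrable_condExp
      stronglyMeasurable_condExp.aestronglyMeasurable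
  refine hMm.congr (ae_eq_condExp_of_forall_setIntegral_eq h2 iS
    (fun _ _ _ => integrable_condExp.integrableOn) ?_ hM2)
  intro t ht _
  have iT := cisq_ind_int (μ := μ) (h2 _ ht)
  have hb : ∀ s : Set α, ∃ C, ∀ x, |s.indicator (fun _ => (1 : ℝ)) x| ≤ C := fun s =>
    ⟨1, fun x => by by_cases hx : x ∈ s <;> simp [hx]⟩
  have key := hC (s.indicator fun _ => 1) (t.indicator fun _ => 1)
    ((@measurable_const _ _ _ m1 _).indicator hs) ((@measurable_const _ _ _ m2 _).indicator ht)
    (hb s) (hb t)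
  have iG : Integrable (μ[s.indicator (fun _ => (1 : ℝ))|meetAlg μ m1 m2] *
      t.indicator (fun _ => (1 : ℝ))) μ :=
    (integrable_condExp (μ := μ) (f := s.indicator (fun _ => (1 : ℝ)))).mul_bdd (c := 1) iT.aestronglyMeasurable (Eventually.of_forall fun x => by
      by_cases hx : x ∈ t <;> simp [hx])
  have pull := condExp_mul_of_stronglyMeasurable_left (m := meetAlg μ m1 m2) (μ := μ)
    stronglyMeasurable_condExp iG iT
  have e := integral_congr_ae (pull.trans key.symm)
  rw [integral_condExp hML, integral_condExp hML] at e
  have conv : ∀ g : α → ℝ, ∫ x in t, g x ∂μ = ∫ x, g x * t.indicator (fun _ => (1 : ℝ)) x ∂μ := by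
    intro g
    rw [← integral_indicator (h2 _ ht)]
    congr 1
    ext x
    by_cases hx : x ∈ t <;> simp [hx]
  rw [conv, conv]
  exact e

theorem CondIndepRel.swap_s7 {m1 m2 : MeasurableSpace α}
    (hC : CondIndepRel μ m1 m2 (meetAlg μ m1 m2)) :
    CondIndepRel μ m2 m1 (meetAlg μ m2 m1) := by
  have e : meetAlg μ m2 m1 = meetAlg μ m1 m2 := by
    ext s
    exact ⟨fun h => ⟨h.1, h.2.2, h.2.1⟩, fun h => ⟨h.1, h.2.2, h.2.1⟩⟩
  rw [e]
  intro f0 f1 h0 h1 b0 b1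
  have := hC f1 f0 h1 h0 b1 b0
  simpa only [mul_comm] using this

theorem CISQ.symm {m1 m2 m : MeasurableSpace α} (hQ : CISQ μ m1 m2 m) (h1 : m1 ≤ mα)
    (h2 : m2 ≤ mα) (hm1 : m ≤ m1) (hm2 : m ≤ m2) : CISQ μ m2 m1 m := by
  obtain ⟨a, b⟩ := hQ.toRel h1 h2 hm1 hm2
  have e : meetAlg μ m2 m1 = meetAlg μ m1 m2 := by
    ext s
    exact ⟨fun h => ⟨h.1, h.2.2, h.2.1⟩, fun h => ⟨h.1, h.2.2, h.2.1⟩⟩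
  exact cisq_of_rel h2 h1 hm1 a.swap_s7 (e ▸ b)

/-- Composition: `f` is first conditioned on `m2`, then on the smaller `m3`. -/
theorem CISQ.trans {m1 m2 m m3 m' : MeasurableSpace α} (hQ : CISQ μ m1 m2 m)
    (hQ' : CISQ μ m m3 m') (h2 : m2 ≤ mα) (h32 : m3 ≤ m2) : CISQ μ m1 m3 m' := by
  intro f hf hfm
  exact (hQ' _ integrable_condExp (hQ f hf hfm)).congr (condExp_condExp_of_le h32 h2)

theorem CISQ.mono {m1 m1' m2 m m' : MeasurableSpace α} (hQ : CISQ μ m1 m2 m)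
    (h1 : m1' ≤ m1) (h : m ≤ m') : CISQ μ m1' m2 m' :=
  fun f hf hfm => (hQ f hf (hfm.mono h1)).mono h

/-- Pull-out: a factor measurable for both `m2` and `m`. -/
theorem CISQ.sup_left {m1 m1' m2 m : MeasurableSpace α} (h1 : m1 ≤ mα)
    (h2 : m2 ≤ mα) (hm : m ≤ mα) (h1'2 : m1' ≤ m2) (h1'm : m1' ≤ m) (hQ : CISQ μ m1 m2 m) :
    CISQ μ (m1' ⊔ m1) m2 m := by
  refine CISQ.of_sup (h1'm.trans hm) h1 h2 hm fun s t hs ht => ?_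
  have e : (s ∩ t).indicator (fun _ => (1 : ℝ)) =
      s.indicator (fun _ => (1 : ℝ)) * t.indicator (fun _ => (1 : ℝ)) := by
    ext x
    by_cases hx : x ∈ s <;> by_cases hx' : x ∈ t <;> simp [hx, hx']
  have iT := cisq_ind_int (μ := μ) (h1 _ ht)
  have iST : Integrable (s.indicator (fun _ => (1 : ℝ)) * t.indicator (fun _ => (1 : ℝ))) μ :=
    e ▸ cisq_ind_int ((hm _ (h1'm _ hs)).inter (h1 _ ht))
  rw [e]
  refine AEStronglyMeasurable.congr ?_ (condExp_mul_of_stronglyMeasurable_left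
    ((@stronglyMeasurable_const _ _ m2 _ _).indicator (h1'2 _ hs)) iST iT).symm
  exact (((@stronglyMeasurable_const _ _ m _ _).indicator (h1'm _ hs)).aestronglyMeasurable).mul
    (hQ _ iT ((@stronglyMeasurable_const _ _ m1 _ _).indicator ht).aestronglyMeasurable)

end CISProof

section CISCyl

variable {Ω S : Type*} [MeasurableSpace Ω]

theorem cyl_eq (T : Set S) : (cylinderAlg S T : MeasurableSpace (S → Ω)) =
    ⨆ i : T, MeasurableSpace.comap (fun ω => ω i) inferInstance := by
  unfold cylinderAlg MeasurableSpace.pi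
  rw [MeasurableSpace.comap_iSup]
  simp only [MeasurableSpace.comap_comp]
  rfl

theorem cyl_le (T : Set S) : (cylinderAlg S T : MeasurableSpace (S → Ω)) ≤ MeasurableSpace.pi := by
  rw [cyl_eq]
  exact iSup_le fun i => (measurable_pi_apply (i : S)).comap_le

theorem cyl_mono {T T' : Set S} (h : T ⊆ T') :
    (cylinderAlg S T : MeasurableSpace (S → Ω)) ≤ cylinderAlg S T' := by
  rw [cyl_eq, cyl_eq]
  exact iSup_le fun i => le_iSup
    (fun i : T' => MeasurableSpace.comap (fun ω : S → Ω => ω i) inferInstance) ⟨i, h i.2⟩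

theorem cyl_union (T T' : Set S) :
    (cylinderAlg S (T ∪ T') : MeasurableSpace (S → Ω)) = cylinderAlg S T ⊔ cylinderAlg S T' := by
  apply le_antisymm
  · rw [cyl_eq (T ∪ T')]
    refine iSup_le ?_
    rintro ⟨i, hi | hi⟩
    · refine le_trans ?_ le_sup_left
      rw [cyl_eq]
      exact le_iSup
        (fun i : T => MeasurableSpace.comap (fun ω : S → Ω => ω i) inferInstance) ⟨i, hi⟩
    · refine le_trans ?_ le_sup_right
      rw [cyl_eq]
      exact le_iSup
        (fun i : T' => MeasurableSpace.comap (fun ω : S → Ω => ω i) inferInstance) ⟨i, hi⟩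
  · exact sup_le (cyl_mono subset_union_left) (cyl_mono subset_union_right)

/-- `T ⊥ T'` in terms of conditional expectations. -/
def CISP (μ : Measure (S → Ω)) (T T' : Set S) : Prop :=
  CISQ μ (cylinderAlg S T) (cylinderAlg S T') (cylinderAlg S (T ∩ T'))

variable {μ : Measure (S → Ω)} [IsProbabilityMeasure μ]

theorem BotRel.cisp {T T' : Set S} (h : BotRel μ T T') : CISP μ T T' :=
  cisq_of_rel (cyl_le _) (cyl_le _) (cyl_mono inter_subset_right) h.1 h.2

theorem CISP.bot {T T' : Set S} (h : CISP μ T T') : BotRel μ T T' :=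
  CISQ.toRel h (cyl_le _) (cyl_le _) (cyl_mono inter_subset_left) (cyl_mono inter_subset_right)

theorem CISP.symm {T T' : Set S} (h : CISP μ T T') : CISP μ T' T := by
  have := CISQ.symm h (cyl_le _) (cyl_le _) (cyl_mono inter_subset_left)
    (cyl_mono inter_subset_right)
  rwa [inter_comm] at this

theorem CISP.trans {A B C : Set S} (h : CISP μ A B) (h' : CISP μ (A ∩ B) C) (hCB : C ⊆ B) :
    CISP μ A C := by
  have := CISQ.trans h h' (cyl_le _) (cyl_mono hCB)
  rwa [inter_assoc, inter_eq_right.2 hCB] at this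

theorem CISP.union_left {A B C : Set S} (h : CISP μ A C) (hB : B ⊆ C) : CISP μ (B ∪ A) C := by
  unfold CISP
  rw [cyl_union]
  exact CISQ.sup_left (cyl_le _) (cyl_le _) (cyl_le _) (cyl_mono hB)
    (cyl_mono fun x hx => ⟨Or.inl hx, hB hx⟩)
    (CISQ.mono h le_rfl (cyl_mono (inter_subset_inter_left _ subset_union_right)))

theorem CISP.union_right {A B C : Set S} (h : CISP μ A C) (hB : B ⊆ C) : CISP μ (A ∪ B) C := by
  rw [union_comm]
  exact h.union_left hB

/-- Any `U ⊆ T1 ∪ T2` of the lattice is independent of any `W ⊆ T1`. -/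
theorem cisp_aux {Lambda : Set (Set S)}
    (hInter : ∀ T1 ∈ Lambda, ∀ T2 ∈ Lambda, T1 ∩ T2 ∈ Lambda)
    {T1 T2 : Set S} (hT1 : T1 ∈ Lambda) (hT2 : T2 ∈ Lambda)
    (hcis1 : HasCIS μ Lambda T1) (hcis2 : HasCIS μ Lambda T2) (h : CISP μ T2 T1)
    {U W : Set S} (hU : U ∈ Lambda) (hUT : U ⊆ T1 ∪ T2) (hW : W ∈ Lambda) (hWT : W ⊆ T1) :
    CISP μ U W := by
  -- `U ∩ T2` against `T1`
  have a : CISP μ (T1 ∩ T2) (U ∩ T2) := (hcis2 _ (hInter _ hT1 _ hT2) _ (hInter _ hU _ hT2)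
    inter_subset_right inter_subset_right).cisp
  have b : CISP μ (U ∩ T2) T1 := by
    apply CISP.symm
    refine CISP.trans (B := T2) h.symm a inter_subset_right
  have c : CISP μ U T1 := by
    have := b.union_left (B := U ∩ T1) inter_subset_right
    rwa [← inter_union_distrib_left, inter_eq_left.2 hUT] at this
  exact c.trans (hcis1 _ (hInter _ hU _ hT1) _ hW inter_subset_right hWT).cisp hWT

theorem cisp_main {Lambda : Set (Set S)}
    (hUnion : ∀ T1 ∈ Lambda, ∀ T2 ∈ Lambda, T1 ∪ T2 ∈ Lambda)
    (hInter : ∀ T1 ∈ Lambda, ∀ T2 ∈ Lambda, T1 ∩ T2 ∈ Lambda)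
    {T1 T2 : Set S} (hT1 : T1 ∈ Lambda) (hT2 : T2 ∈ Lambda)
    (hcis1 : HasCIS μ Lambda T1) (hcis2 : HasCIS μ Lambda T2) (h : CISP μ T1 T2)
    {U V : Set S} (hU : U ∈ Lambda) (hUT : U ⊆ T1 ∪ T2) (hV : V ∈ Lambda)
    (hVT : V ⊆ T1 ∪ T2) : CISP μ U V := by
  have hU1 := hInter _ hU _ hT1
  have hU2 := hInter _ hU _ hT2
  have hV1 := hUnion _ hV _ hT1
  -- condition on `V ∪ T1` first
  have a : CISP μ (U ∩ T2) (V ∪ T1) :=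
    (cisp_aux hInter hT2 hT1 hcis2 hcis1 h hV1
      (union_subset (hVT.trans (union_comm _ _).subset) subset_union_right) hU2
      inter_subset_right).symm
  have b : CISP μ U (V ∪ T1) := by
    have := a.union_left (B := U ∩ T1) (inter_subset_right.trans subset_union_right)
    rwa [← inter_union_distrib_left, inter_eq_left.2 hUT] at this
  have c : CISP μ (U ∩ T1) V :=
    (cisp_aux hInter hT1 hT2 hcis1 hcis2 h.symm hV hVT hU1 inter_subset_right).symm
  refine b.trans ?_ subset_union_left
  have := c.union_left (B := U ∩ V) inter_subset_right
  rwa [← inter_union_distrib_left] at this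

end CISCyl

/-- **The CIS property is preserved by unions of conditionally independent sets**
(Proposition 2.29). If `Λ` is a set lattice in a finite set `S` (closed under unions and
intersections), `T₁, T₂ ∈ Λ` both have the CIS property in `Λ` and `T₁ ⊥_μ T₂`, then
`T₁ ∪ T₂` has the CIS property in `Λ`. -/
theorem hasCIS_union
    {Ω : Type*} [mΩ : MeasurableSpace Ω] (lam : Measure Ω) [IsProbabilityMeasure lam]
    {S : Type*} [Fintype S]
    (μ : Measure (S → Ω)) (hcoup : ∀ v : S, μ.map (fun ω => ω v) = lam)
    (Lambda : Set (Set S))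
    (hUnion : ∀ T1 ∈ Lambda, ∀ T2 ∈ Lambda, T1 ∪ T2 ∈ Lambda)
    (hInter : ∀ T1 ∈ Lambda, ∀ T2 ∈ Lambda, T1 ∩ T2 ∈ Lambda)
    (T1 T2 : Set S) (hT1 : T1 ∈ Lambda) (hT2 : T2 ∈ Lambda)
    (hcis1 : HasCIS μ Lambda T1) (hcis2 : HasCIS μ Lambda T2)
    (hbot : BotRel μ T1 T2) :
    HasCIS μ Lambda (T1 ∪ T2) := by
  rcases isEmpty_or_nonempty S with hS | ⟨⟨v⟩⟩
  · intro U _ V _ _ _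
    have e : ∀ A B : Set S, A = B := fun A B => Subsingleton.elim A B
    rwa [e U T1, e V T2]
  · haveI : IsProbabilityMeasure μ := ⟨by
      have h := measure_univ (μ := lam)
      rwa [← hcoup v, Measure.map_apply (measurable_pi_apply v) MeasurableSet.univ,
        preimage_univ] at h⟩
    intro U hU V hV hUT hVT
    exact (cisp_main hUnion hInter hT1 hT2 hcis1 hcis2 hbot.cisp hU hUT hV hVT).bot
end

section
/- Let (Ω, 𝒜, λ) be a probability space, ℬ ⊆ 𝒜 a sub-σ-algebra, and μ a measure on (Ω × Ω, 𝒜 ⊗ 𝒜) that is the square of λ relative to ℬ. Write p_a, p_b : Ω × Ω → Ω for the first and second coordinate projections. Then: (i) for every A ∈ ℬ, μ(p_a^{-1}(A) Δ p_b^{-1}(A)) = 0, so the σ-algebras p_a^{-1}(ℬ) and p_b^{-1}(ℬ) agree up to μ-null sets; (ii) the coordinate σ-algebras p_a^{-1}(𝒜) and p_b^{-1}(𝒜) are conditionally independent relative to 𝒢 := p_a^{-1}(ℬ) with respect to μ; (iii) 𝒢 agrees up to μ-null sets with p_a^{-1}(𝒜) ∧_μ p_b^{-1}(𝒜); in particular,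 p_a^{-1}(𝒜) and p_b^{-1}(𝒜) are conditionally independent relative to their meet. -/
open MeasureTheory Set

/-- `μ` is the square of `lam` relative to the sub-σ-algebra `B`:
`μ(A₀ × A₁) = ∫ E(1_{A₀}|B) ⬝ E(1_{A₁}|B) dlam` for all measurable `A₀, A₁`. -/
def IsRelativeSquare {Ω : Type*} {mΩ : MeasurableSpace Ω} (lam : Measure Ω)
    (B : MeasurableSpace Ω) (μ : @Measure (Ω × Ω) (mΩ.prod mΩ)) : Prop :=
  ∀ A0 A1 : Set Ω, MeasurableSet[mΩ] A0 → MeasurableSet[mΩ] A1 →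
    μ (A0 ×ˢ A1) = ENNReal.ofReal (∫ x,
      (lam[A0.indicator (fun _ => (1 : ℝ))|B]) x *
        (lam[A1.indicator (fun _ => (1 : ℝ))|B]) x ∂lam)

theorem rs_swap {Ω : Type*} {B mΩ : MeasurableSpace Ω} (lam : Measure Ω)
    [IsProbabilityMeasure lam] (hB : B ≤ mΩ) (f g : Ω → ℝ) (hf : Integrable f lam)
    (C : ℝ) (hg : ∀ x, |g x| ≤ C) :
    ∫ x, f x * (lam[g|B]) x ∂lam = ∫ x, (lam[f|B]) x * (lam[g|B]) x ∂lam := by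
  have hbd : ∀ᵐ x ∂lam, ‖(lam[g|B]) x‖ ≤ C := by
    have h0 : 0 ≤ C := by
      obtain ⟨x⟩ : Nonempty Ω := lam.nonempty_of_neZero
      exact (abs_nonneg _).trans (hg x)
    exact ae_bdd_condExp_of_ae_bdd (R := ⟨C, h0⟩) (Filter.Eventually.of_forall hg)
  have hi : Integrable (f * lam[g|B]) lam :=
    hf.mul_bdd (c := C) integrable_condExp.aestronglyMeasurable hbd
  have h := condExp_mul_of_stronglyMeasurable_right (m := B) (μ := lam) (f := f) (g := lam[g|B])
    stronglyMeasurable_condExp hi hf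
  have h2 := integral_congr_ae h
  rw [integral_condExp hB] at h2
  exact h2

theorem rs_swap' {Ω : Type*} {B mΩ : MeasurableSpace Ω} (lam : Measure Ω)
    [IsProbabilityMeasure lam] (hB : B ≤ mΩ) (f g : Ω → ℝ) (hf : Integrable f lam)
    (C : ℝ) (hg : ∀ x, |g x| ≤ C) :
    ∫ x, (lam[g|B]) x * f x ∂lam = ∫ x, (lam[g|B]) x * (lam[f|B]) x ∂lam := by
  have := rs_swap lam hB f g hf C hg
  simpa only [mul_comm] using this

theorem rs_ind_bdd {Ω : Type*} (A : Set Ω) (x : Ω) :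
    |A.indicator (fun _ => (1 : ℝ)) x| ≤ 1 := by
  by_cases h : x ∈ A <;> simp [h]

theorem rs_ind_int {Ω : Type*} {mΩ : MeasurableSpace Ω} (lam : Measure Ω)
    [IsProbabilityMeasure lam] {A : Set Ω} (hA : MeasurableSet A) :
    Integrable (A.indicator (fun _ => (1 : ℝ))) lam :=
  (integrable_const (1 : ℝ)).indicator hA

theorem rs_map_snd {Ω : Type*} {B mΩ : MeasurableSpace Ω} (lam : Measure Ω)
    [IsProbabilityMeasure lam] (hB : B ≤ mΩ) (μ : Measure (Ω × Ω))
    (hμ : IsRelativeSquare lam B μ) {A : Set Ω} (hA : MeasurableSet A) :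
    (μ.restrict (Prod.fst ⁻¹' A)).map Prod.snd =
      lam.withDensity (fun x => ENNReal.ofReal
        ((lam[A.indicator (fun _ => (1 : ℝ))|B]) x)) := by
  ext S hS
  rw [Measure.map_apply measurable_snd hS, Measure.restrict_apply (measurable_snd hS),
    withDensity_apply _ hS]
  have h1 : Prod.snd ⁻¹' S ∩ Prod.fst ⁻¹' A = A ×ˢ S := by
    ext x; simp [and_comm]
  rw [h1, hμ A S hA hS, ← rs_swap' lam hB _ _ (rs_ind_int lam hS) 1 (rs_ind_bdd A)]
  rw [← ofReal_integral_eq_lintegral_ofReal integrable_condExp.integrableOn]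
  · rw [← integral_indicator hS]
    congr 2
    ext x
    by_cases h : x ∈ S <;> simp [h]
  · apply ae_restrict_of_ae
    exact condExp_nonneg (Filter.Eventually.of_forall fun x =>
      Set.indicator_nonneg (fun _ _ => zero_le_one) x)

theorem rs_setIntegral {Ω : Type*} {B mΩ : MeasurableSpace Ω} (lam : Measure Ω)
    [IsProbabilityMeasure lam] (hB : B ≤ mΩ) (μ : Measure (Ω × Ω))
    (hμ : IsRelativeSquare lam B μ) {A : Set Ω} (hA : MeasurableSet A)
    (f : Ω → ℝ) (hf : Measurable f) (C : ℝ) (hC : ∀ x, |f x| ≤ C) :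
    ∫ x in Prod.fst ⁻¹' A, f x.2 ∂μ = ∫ x in A, (lam[f|B]) x ∂lam := by
  have hfi : Integrable f lam :=
    Integrable.of_bound hf.aestronglyMeasurable C (Filter.Eventually.of_forall hC)
  rw [← integral_map (φ := Prod.snd) (f := f) measurable_snd.aemeasurable
    hf.aestronglyMeasurable, rs_map_snd lam hB μ hμ hA,
    integral_withDensity_eq_integral_toReal_smul]
  · have h0 : 0 ≤ᵐ[lam] lam[A.indicator (fun _ => (1 : ℝ))|B] :=
      condExp_nonneg (Filter.Eventually.of_forall fun x =>
        Set.indicator_nonneg (fun _ _ => zero_le_one) x)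
    have h1 : ∫ x, (ENNReal.ofReal ((lam[A.indicator (fun _ => (1 : ℝ))|B]) x)).toReal • f x ∂lam
        = ∫ x, (lam[A.indicator (fun _ => (1 : ℝ))|B]) x * f x ∂lam := by
      apply integral_congr_ae
      filter_upwards [h0] with x hx
      rw [ENNReal.toReal_ofReal hx, smul_eq_mul]
    rw [h1, rs_swap' lam hB _ _ hfi 1 (rs_ind_bdd A),
      ← rs_swap lam hB _ _ (rs_ind_int lam hA) C hC, ← integral_indicator hA]
    congr 1
    ext x
    by_cases h : x ∈ A <;> simp [h]
  · exact (stronglyMeasurable_condExp.mono hB).measurable.ennreal_ofReal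
  · simp

theorem rs_univ {Ω : Type*} {B mΩ : MeasurableSpace Ω} (lam : Measure Ω)
    [IsProbabilityMeasure lam] (hB : B ≤ mΩ) (μ : Measure (Ω × Ω))
    (hμ : IsRelativeSquare lam B μ) {A : Set Ω} (hA : MeasurableSet A) :
    μ (Prod.fst ⁻¹' A) = lam A := by
  have h1 : Prod.fst ⁻¹' A = A ×ˢ (Set.univ : Set Ω) := by ext x; simp
  have h2 : (Set.univ : Set Ω).indicator (fun _ => (1 : ℝ)) = fun _ => 1 := by simp
  rw [h1, hμ A _ hA MeasurableSet.univ, h2, condExp_const hB]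
  simp only [mul_one]
  rw [integral_condExp hB, integral_indicator hA]
  simp

theorem rs_map_fst {Ω : Type*} {B mΩ : MeasurableSpace Ω} (lam : Measure Ω)
    [IsProbabilityMeasure lam] (hB : B ≤ mΩ) (μ : Measure (Ω × Ω))
    (hμ : IsRelativeSquare lam B μ) : μ.map Prod.fst = lam := by
  ext S hS
  rw [Measure.map_apply measurable_fst hS, rs_univ lam hB μ hμ hS]

theorem rs_prob {Ω : Type*} {B mΩ : MeasurableSpace Ω} (lam : Measure Ω)
    [IsProbabilityMeasure lam] (hB : B ≤ mΩ) (μ : Measure (Ω × Ω))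
    (hμ : IsRelativeSquare lam B μ) : IsProbabilityMeasure μ := by
  constructor
  have := rs_univ lam hB μ hμ MeasurableSet.univ
  simpa using this

/-- The key identity: conditioning a function of the second coordinate on the first. -/
theorem rs_condExp_fst {Ω : Type*} {B mΩ : MeasurableSpace Ω} (lam : Measure Ω)
    [IsProbabilityMeasure lam] (hB : B ≤ mΩ) (μ : Measure (Ω × Ω))
    (hμ : IsRelativeSquare lam B μ)
    (f : Ω → ℝ) (hf : Measurable f) (C : ℝ) (hC : ∀ x, |f x| ≤ C) :
    (fun x => (lam[f|B]) x.1) =ᵐ[μ] μ[fun x => f x.2|MeasurableSpace.comap Prod.fst mΩ] := by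
  have := rs_prob lam hB μ hμ
  have hmp : MeasurePreserving Prod.fst μ lam := ⟨measurable_fst, rs_map_fst lam hB μ hμ⟩
  have hle : MeasurableSpace.comap Prod.fst mΩ ≤ (mΩ.prod mΩ) := measurable_fst.comap_le
  have hint : Integrable (fun x : Ω × Ω => (lam[f|B]) x.1) μ :=
    hmp.integrable_comp_of_integrable integrable_condExp
  refine ae_eq_condExp_of_forall_setIntegral_eq hle ?_ ?_ ?_ ?_
  · exact Integrable.of_bound (hf.comp measurable_snd).aestronglyMeasurable C
      (Filter.Eventually.of_forall fun x => hC x.2)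
  · intro s _ _
    exact hint.integrableOn
  · rintro s ⟨A, hA, rfl⟩ _
    rw [rs_setIntegral lam hB μ hμ hA f hf C hC]
    have h := integral_map (μ := μ.restrict (Prod.fst ⁻¹' A)) (φ := Prod.fst) (f := lam[f|B])
      measurable_fst.aemeasurable (stronglyMeasurable_condExp.mono hB).aestronglyMeasurable
    rw [← h, ← Measure.restrict_map measurable_fst hA, hmp.map_eq]
  · apply StronglyMeasurable.aestronglyMeasurable
    exact (stronglyMeasurable_condExp.mono hB).comp_measurable
      (comap_measurable (m := mΩ) Prod.fst)

theorem rs_symm {Ω : Type*} {B mΩ : MeasurableSpace Ω} (lam : Measure Ω)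
    [IsProbabilityMeasure lam] (hB : B ≤ mΩ) (μ : Measure (Ω × Ω))
    (hμ : IsRelativeSquare lam B μ) (A : Set Ω) (hA : MeasurableSet[B] A) :
    μ (symmDiff (Prod.fst ⁻¹' A) (Prod.snd ⁻¹' A)) = 0 := by
  have key : ∀ S : Set Ω, MeasurableSet[B] S → μ (S ×ˢ Sᶜ) = 0 := by
    intro S hS
    rw [hμ S Sᶜ (hB _ hS) (hB _ hS.compl),
      condExp_of_stronglyMeasurable hB (stronglyMeasurable_const.indicator hS)
        (rs_ind_int lam (hB _ hS)),
      condExp_of_stronglyMeasurable hB (stronglyMeasurable_const.indicator hS.compl)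
        (rs_ind_int lam (hB _ hS.compl))]
    have : ∀ x, S.indicator (fun _ => (1 : ℝ)) x * Sᶜ.indicator (fun _ => (1 : ℝ)) x = 0 := by
      intro x
      by_cases h : x ∈ S <;> simp [h]
    simp [this]
  have h1 := key A hA
  have h2 := key Aᶜ hA.compl
  refine measure_mono_null ?_ (measure_union_null h1 h2)
  rintro ⟨x, y⟩ h
  simpa [Set.mem_symmDiff, and_comm] using h

theorem rs_condExp_congr {α : Type*} {m m' mα : MeasurableSpace α} (μ : Measure α)
    [IsFiniteMeasure μ] (hm : m ≤ m') (hm' : m' ≤ mα)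
    (H : ∀ s, MeasurableSet[m'] s → ∃ t, MeasurableSet[m] t ∧ μ (symmDiff s t) = 0)
    (f : α → ℝ) (hf : Integrable f μ) : μ[f|m] =ᵐ[μ] μ[f|m'] := by
  refine ae_eq_condExp_of_forall_setIntegral_eq hm' hf ?_ ?_ ?_
  · intro s _ _
    exact integrable_condExp.integrableOn
  · intro s hs _
    obtain ⟨t, ht, hst⟩ := H s hs
    have hae : s =ᵐ[μ] t := measure_symmDiff_eq_zero_iff.1 hst
    rw [setIntegral_congr_set hae, setIntegral_congr_set hae,
      setIntegral_condExp (hm.trans hm') hf ht]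
  · exact (stronglyMeasurable_condExp.mono hm).aestronglyMeasurable

theorem rs_condIndep {Ω : Type*} {B mΩ : MeasurableSpace Ω} (lam : Measure Ω)
    [IsProbabilityMeasure lam] (hB : B ≤ mΩ) (μ : Measure (Ω × Ω))
    (hμ : IsRelativeSquare lam B μ) :
    CondIndepRel μ (MeasurableSpace.comap Prod.fst mΩ) (MeasurableSpace.comap Prod.snd mΩ)
      (MeasurableSpace.comap Prod.fst B) := by
  have := rs_prob lam hB μ hμ
  rintro f0 f1 hf0 hf1 ⟨C0, hC0⟩ ⟨C1, hC1⟩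
  have hle : MeasurableSpace.comap Prod.fst mΩ ≤ (mΩ.prod mΩ) := measurable_fst.comap_le
  have hle2 : MeasurableSpace.comap Prod.snd mΩ ≤ (mΩ.prod mΩ) := measurable_snd.comap_le
  have hBle : MeasurableSpace.comap (Prod.fst : Ω × Ω → Ω) B ≤ MeasurableSpace.comap Prod.fst mΩ :=
    MeasurableSpace.comap_mono hB
  obtain ⟨y0⟩ : Nonempty Ω := lam.nonempty_of_neZero
  obtain ⟨g, hg, hgC, rfl⟩ : ∃ g : Ω → ℝ, Measurable g ∧ (∀ x, |g x| ≤ C1) ∧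
      f1 = fun x => g x.2 := by
    obtain ⟨g, hg, hgf⟩ := hf1.exists_eq_measurable_comp
    refine ⟨g, hg, fun x => ?_, hgf⟩
    have := hC1 (y0, x)
    rwa [hgf] at this
  have hi0 : Integrable f0 μ := Integrable.of_bound (hf0.mono hle le_rfl).aestronglyMeasurable C0
      (Filter.Eventually.of_forall hC0)
  have hi1 : Integrable (fun x : Ω × Ω => g x.2) μ :=
    Integrable.of_bound (hg.comp measurable_snd).aestronglyMeasurable C1
      (Filter.Eventually.of_forall hC1)
  have hi01 : Integrable (f0 * fun x : Ω × Ω => g x.2) μ :=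
    hi1.bdd_mul (c := C0) hi0.aestronglyMeasurable (Filter.Eventually.of_forall hC0)
  have hk := rs_condExp_fst lam hB μ hμ g hg C1 hgC
  set h : Ω × Ω → ℝ := fun x => (lam[g|B]) x.1 with hh
  have hhm : StronglyMeasurable[MeasurableSpace.comap Prod.fst B] h :=
    stronglyMeasurable_condExp.comp_measurable (comap_measurable (m := B) Prod.fst)
  have hhi : Integrable h μ := integrable_condExp.congr hk.symm
  -- conditional expectation of the second function
  have e1 : μ[fun x => g x.2|MeasurableSpace.comap Prod.fst B] =ᵐ[μ] h := by
    refine (condExp_condExp_of_le hBle hle).symm.trans ?_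
    refine (condExp_congr_ae hk.symm).trans ?_
    rw [condExp_of_stronglyMeasurable (hBle.trans hle) hhm hhi]
  have e2 : μ[f0 * fun x => g x.2|MeasurableSpace.comap Prod.fst mΩ] =ᵐ[μ] f0 * h := by
    refine (condExp_mul_of_stronglyMeasurable_left hf0.stronglyMeasurable hi01 hi1).trans ?_
    filter_upwards [hk] with x hx
    simp only [Pi.mul_apply]
    rw [hx]
  have hi0h : Integrable (f0 * h) μ := integrable_condExp.congr e2
  have e3 : μ[f0 * fun x => g x.2|MeasurableSpace.comap Prod.fst B] =ᵐ[μ]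
      μ[f0|MeasurableSpace.comap Prod.fst B] * h := by
    refine (condExp_condExp_of_le hBle hle).symm.trans ?_
    refine (condExp_congr_ae e2).trans ?_
    exact condExp_mul_of_stronglyMeasurable_right hhm hi0h hi0
  refine Filter.EventuallyEq.trans e3 ?_
  filter_upwards [e1] with x hx
  simp only [Pi.mul_apply]
  rw [hx]

theorem rs_meet_le {α : Type*} {mα : MeasurableSpace α} (μ : Measure α)
    (B0 B1 : MeasurableSpace α) : meetAlg μ B0 B1 ≤ mα := fun _ hs => hs.1

theorem rs_le_meet {Ω : Type*} {B mΩ : MeasurableSpace Ω} (lam : Measure Ω)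
    [IsProbabilityMeasure lam] (hB : B ≤ mΩ) (μ : Measure (Ω × Ω))
    (hμ : IsRelativeSquare lam B μ) :
    MeasurableSpace.comap Prod.fst B ≤
      meetAlg μ (MeasurableSpace.comap Prod.fst mΩ) (MeasurableSpace.comap Prod.snd mΩ) := by
  rintro s ⟨A, hA, rfl⟩
  exact ⟨measurable_fst (hB _ hA), ⟨_, ⟨A, hB _ hA, rfl⟩, by simp⟩,
    ⟨_, ⟨A, hB _ hA, rfl⟩, rs_symm lam hB μ hμ A hA⟩⟩

theorem rs_meet_approx {Ω : Type*} {B mΩ : MeasurableSpace Ω} (lam : Measure Ω)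
    [IsProbabilityMeasure lam] (hB : B ≤ mΩ) (μ : Measure (Ω × Ω))
    (hμ : IsRelativeSquare lam B μ) (s : Set (Ω × Ω))
    (hs : MeasurableSet[meetAlg μ (MeasurableSpace.comap Prod.fst mΩ)
      (MeasurableSpace.comap Prod.snd mΩ)] s) :
    ∃ t, MeasurableSet[MeasurableSpace.comap Prod.fst B] t ∧ μ (symmDiff s t) = 0 := by
  have := rs_prob lam hB μ hμ
  obtain ⟨hsm, ⟨_, ⟨A0, hA0, rfl⟩, h0⟩, ⟨_, ⟨A1, hA1, rfl⟩, h1⟩⟩ := hs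
  have hle : MeasurableSpace.comap Prod.fst mΩ ≤ (mΩ.prod mΩ) := measurable_fst.comap_le
  have hk := rs_condExp_fst lam hB μ hμ (A1.indicator (fun _ => (1 : ℝ)))
    (measurable_const.indicator hA1) 1 (rs_ind_bdd A1)
  have a0 := measure_symmDiff_eq_zero_iff.1 h0
  have a1 := measure_symmDiff_eq_zero_iff.1 h1
  have a01 : (fun x : Ω × Ω => A1.indicator (fun _ => (1 : ℝ)) x.2) =ᵐ[μ]
      (fun x : Ω × Ω => A0.indicator (fun _ => (1 : ℝ)) x.1) := by
    filter_upwards [a0.symm.trans a1] with x hx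
    have hx' : (x.1 ∈ A0) = (x.2 ∈ A1) := hx
    by_cases h : x.2 ∈ A1
    · rw [Set.indicator_of_mem h, Set.indicator_of_mem (by rwa [hx'])]
    · rw [Set.indicator_of_notMem h, Set.indicator_of_notMem (by rwa [hx'])]
  have hsm0 : StronglyMeasurable[MeasurableSpace.comap Prod.fst mΩ]
      (fun x : Ω × Ω => A0.indicator (fun _ => (1 : ℝ)) x.1) :=
    (stronglyMeasurable_const.indicator hA0).comp_measurable
      (comap_measurable (m := mΩ) Prod.fst)
  have hi0 : Integrable (fun x : Ω × Ω => A0.indicator (fun _ => (1 : ℝ)) x.1) μ :=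
    Integrable.of_bound (hsm0.mono hle).aestronglyMeasurable 1
      (Filter.Eventually.of_forall fun x => rs_ind_bdd A0 x.1)
  have e := hk.trans (condExp_congr_ae a01)
  rw [condExp_of_stronglyMeasurable hle hsm0 hi0] at e
  refine ⟨Prod.fst ⁻¹' ((lam[A1.indicator (fun _ => (1 : ℝ))|B]) ⁻¹' {1}),
    ⟨_, stronglyMeasurable_condExp.measurable (measurableSet_singleton 1), rfl⟩, ?_⟩
  rw [measure_symmDiff_eq_zero_iff]
  refine a0.trans ?_
  filter_upwards [e] with x hx
  apply propext
  change x.1 ∈ A0 ↔ (lam[A1.indicator (fun _ => (1 : ℝ))|B]) x.1 = 1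
  rw [hx]
  by_cases h : x.1 ∈ A0 <;> simp [h]

/-- **Properties of the square of a measure relative to a factor** (Lemma 2.40).
If `μ` is the square of `lam` relative to `ℬ`, then: (i) for `A ∈ ℬ` the two coordinate
copies of `A` agree up to `μ`-null sets, and hence so do the σ-algebras `p_a⁻¹ℬ`, `p_b⁻¹ℬ`;
(ii) the coordinate σ-algebras are conditionally independent relative to `𝒢 = p_a⁻¹ℬ`;
(iii) `𝒢` agrees up to `μ`-null sets with the meet of the coordinate σ-algebras, and in
particular the coordinate σ-algebras are conditionally independent relative to this meet. -/
theorem relativeSquare_properties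
    {Ω : Type*} [mΩ : MeasurableSpace Ω] (lam : Measure Ω) [IsProbabilityMeasure lam]
    (μ : Measure (Ω × Ω)) (B : MeasurableSpace Ω) (hB : B ≤ mΩ)
    (hμ : IsRelativeSquare lam B μ) :
    (∀ A : Set Ω, MeasurableSet[B] A →
        μ (symmDiff (Prod.fst ⁻¹' A) (Prod.snd ⁻¹' A)) = 0) ∧
    EqModNull μ (MeasurableSpace.comap Prod.fst B) (MeasurableSpace.comap Prod.snd B) ∧
    CondIndepRel μ (MeasurableSpace.comap Prod.fst mΩ) (MeasurableSpace.comap Prod.snd mΩ)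
      (MeasurableSpace.comap Prod.fst B) ∧
    EqModNull μ (MeasurableSpace.comap Prod.fst B)
      (meetAlg μ (MeasurableSpace.comap Prod.fst mΩ) (MeasurableSpace.comap Prod.snd mΩ)) ∧
    CondIndepRel μ (MeasurableSpace.comap Prod.fst mΩ) (MeasurableSpace.comap Prod.snd mΩ)
      (meetAlg μ (MeasurableSpace.comap Prod.fst mΩ) (MeasurableSpace.comap Prod.snd mΩ)) := by
  have hp := rs_prob lam hB μ hμ
  have hsym := rs_symm lam hB μ hμ
  have hci := rs_condIndep lam hB μ hμ
  have hle := rs_le_meet lam hB μ hμ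
  have happ := rs_meet_approx lam hB μ hμ
  refine ⟨hsym, ⟨?_, ?_⟩, hci, ⟨fun s hs => ⟨s, hle s hs, by simp⟩, happ⟩, ?_⟩
  · rintro s ⟨A, hA, rfl⟩
    exact ⟨_, ⟨A, hA, rfl⟩, hsym A hA⟩
  · rintro s ⟨A, hA, rfl⟩
    exact ⟨_, ⟨A, hA, rfl⟩, by rw [symmDiff_comm]; exact hsym A hA⟩
  · rintro f0 f1 hf0 hf1 ⟨C0, hC0⟩ ⟨C1, hC1⟩
    have h := hci f0 f1 hf0 hf1 ⟨C0, hC0⟩ ⟨C1, hC1⟩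
    have hi0 : Integrable f0 μ :=
      Integrable.of_bound (hf0.mono measurable_fst.comap_le le_rfl).aestronglyMeasurable C0
        (Filter.Eventually.of_forall hC0)
    have hi1 : Integrable f1 μ :=
      Integrable.of_bound (hf1.mono measurable_snd.comap_le le_rfl).aestronglyMeasurable C1
        (Filter.Eventually.of_forall hC1)
    have hi01 : Integrable (fun x => f0 x * f1 x) μ :=
      hi1.bdd_mul (c := C0) hi0.aestronglyMeasurable (Filter.Eventually.of_forall hC0)
    have hm := rs_meet_le μ (MeasurableSpace.comap Prod.fst mΩ) (MeasurableSpace.comap Prod.snd mΩ)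
    have c0 := rs_condExp_congr μ hle hm happ f0 hi0
    have c1 := rs_condExp_congr μ hle hm happ f1 hi1
    have c01 := rs_condExp_congr μ hle hm happ _ hi01
    filter_upwards [h, c0, c1, c01] with x h c0 c1 c01
    rw [← c01, h, c0, c1]
end

section
/- Let Ω be a compact metrizable topological space, let λ be a Borel probability measure on Ω whose support is all of Ω (i.e. λ(U) > 0 for every nonempty open U ⊆ Ω), let ℬ be a sub-σ-algebra of the Borel σ-algebra of Ω, and let μ be a Borel measure on Ω × Ω (whose Borel σ-algebra coincides with the product σ-algebra, by second countability) that is the square of λ relative to ℬ. Then the diagonal {(x, x) : x ∈ Ω} is contained in the support of μ; that is, for every x ∈ Ω and every open set U ⊆ Ω × Ω containing (x, x), one has μ(U) > 0. -/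
open MeasureTheory Set

/-- If `A` has positive measure, then `E(1_A | B)` has positive second moment. -/
lemma integral_condExp_sq_pos {Ω : Type*} {B : MeasurableSpace Ω} {mΩ : MeasurableSpace Ω}
    (lam : Measure Ω) [IsProbabilityMeasure lam] (hB : B ≤ mΩ) (A : Set Ω)
    (hA : MeasurableSet[mΩ] A) (hpos : 0 < lam A) :
    0 < ∫ x, (lam[A.indicator (fun _ => (1 : ℝ))|B]) x *
        (lam[A.indicator (fun _ => (1 : ℝ))|B]) x ∂lam := by
  have hint : Integrable (A.indicator (fun _ => (1 : ℝ))) lam :=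
    (integrable_const (1 : ℝ)).indicator hA
  have h2 : MemLp (A.indicator (fun _ => (1 : ℝ))) 2 lam :=
    (memLp_const (1 : ℝ)).indicator hA
  have hg2 : MemLp (lam[A.indicator (fun _ => (1 : ℝ))|B]) 2 lam := h2.condExp (by norm_num)
  have hgi : Integrable (fun x => (lam[A.indicator (fun _ => (1 : ℝ))|B]) x *
        (lam[A.indicator (fun _ => (1 : ℝ))|B]) x) lam := hg2.integrable_mul hg2
  have hnn : 0 ≤ fun x => (lam[A.indicator (fun _ => (1 : ℝ))|B]) x *
        (lam[A.indicator (fun _ => (1 : ℝ))|B]) x := fun x => mul_self_nonneg _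
  refine lt_of_le_of_ne (integral_nonneg hnn) fun h0 => ?_
  have hz := (integral_eq_zero_iff_of_nonneg hnn hgi).1 h0.symm
  have hg0 : lam[A.indicator (fun _ => (1 : ℝ))|B] =ᵐ[lam] 0 := by
    filter_upwards [hz] with x hx
    exact mul_self_eq_zero.1 hx
  have h1 : ∫ x, (lam[A.indicator (fun _ => (1 : ℝ))|B]) x ∂lam = 0 := by
    rw [integral_congr_ae hg0]; simp
  rw [integral_condExp hB, integral_indicator_const _ hA] at h1
  have h3 : lam.real A = 0 := by simpa using h1
  rw [measureReal_eq_zero_iff] at h3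
  exact hpos.ne' h3

/-- **The support of a relative square contains the diagonal** (Lemma 2.57).
Let `Ω` be a compact metrizable space, `lam` a fully supported Borel probability measure
on `Ω`, `ℬ` a sub-σ-algebra of the Borel σ-algebra, and `μ` the square of `lam` relative
to `ℬ`. Then every open neighbourhood of a diagonal point `(x, x)` has positive
`μ`-measure. -/
theorem relativeSquare_support_contains_diagonal
    {Ω : Type*} [TopologicalSpace Ω] [CompactSpace Ω] [TopologicalSpace.MetrizableSpace Ω]
    [mΩ : MeasurableSpace Ω] [BorelSpace Ω]
    (lam : Measure Ω) [IsProbabilityMeasure lam]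
    (hsupp : ∀ U : Set Ω, IsOpen U → U.Nonempty → 0 < lam U)
    (μ : Measure (Ω × Ω)) (B : MeasurableSpace Ω) (hB : B ≤ mΩ)
    (hμ : IsRelativeSquare lam B μ) :
    ∀ x : Ω, ∀ U : Set (Ω × Ω), IsOpen U → (x, x) ∈ U → 0 < μ U := by
  intro x U hU hx
  obtain ⟨V, W, hV, hW, hxV, hxW, hsub⟩ := isOpen_prod_iff.1 hU x x hx
  have hO : IsOpen (V ∩ W) := hV.inter hW
  have hM : MeasurableSet[mΩ] (V ∩ W) := @IsOpen.measurableSet Ω _ _ mΩ _ hO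
  have h := hμ (V ∩ W) (V ∩ W) hM hM
  have hs : (V ∩ W) ×ˢ (V ∩ W) ⊆ U :=
    (Set.prod_mono inter_subset_left inter_subset_right).trans hsub
  refine lt_of_lt_of_le ?_ (measure_mono hs)
  rw [h, ENNReal.ofReal_pos]
  exact integral_condExp_sq_pos lam hB _ hM (hsupp _ hO ⟨x, hxV, hxW⟩)
end
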